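/- Let n ≥ 3 be a natural number and let f⁺, f⁻, g⁺, g⁻ be real polynomials in two variables of degree at most n. For h ∈ (0, 1/64), set u(h) = √(1 − 8√h) ∈ (0,1), x₀(h) = (1 − u(h))/2, x₁(h) = (1 + u(h))/2, and Y^±(x,h) = (1−x)/2 ± √(x⁴ − 2x³ + x² − 4h)/(2x) for x ∈ [x₀(h), x₁(h)] (these are the upper and lower arcs, relative to the line y = (1−x)/2, of the closed level curve x²y(1−x−y) = h of the Hamiltonian H(x,y) = x²y(1−x−y)). Define the first-order Melnikov function I(h) = ∫_{x₀(h)}^{x₁(h)} [ g⁺(x, Y⁺(x,h)) − f⁺(x, Y⁺(x,h))·∂Y⁺/∂x(x,h) ] dx − ∫_{x₀(h)}^{x₁(h)} [ g⁻(x, Y⁻(x,h)) − f⁻(x, Y⁻(x,h))·∂Y⁻/∂x(x,h) ] dx. If I is not identically zero on (0, 1/64), then the number of zeros of I in (0, 1/64), counted with multiplicity, is at most ⌊11n/2⌋ + 43. -/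

import Mathlib

/-- Multiplicity (order of vanishing) of a zero of a real function. -/
noncomputable def zeroMult (φ : ℝ → ℝ) (x : ℝ) : ℕ :=
  sInf {n : ℕ | iteratedDeriv n φ x ≠ 0}

/-- `u(h) = √(1 - 8√h)`. -/
noncomputable def uh (h : ℝ) : ℝ := Real.sqrt (1 - 8 * Real.sqrt h)

/-- Left endpoint `x₀(h)`. -/
noncomputable def x0 (h : ℝ) : ℝ := (1 - uh h) / 2

/-- Right endpoint `x₁(h)`. -/
noncomputable def x1 (h : ℝ) : ℝ := (1 + uh h) / 2

/-- Upper arc `Y⁺(x,h)` of the level curve `x²y(1-x-y) = h` relative to `y = (1-x)/2`. -/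
noncomputable def Yp (h x : ℝ) : ℝ :=
  (1 - x) / 2 + Real.sqrt (x ^ 4 - 2 * x ^ 3 + x ^ 2 - 4 * h) / (2 * x)

/-- Lower arc `Y⁻(x,h)` of the level curve `x²y(1-x-y) = h` relative to `y = (1-x)/2`. -/
noncomputable def Ym (h x : ℝ) : ℝ :=
  (1 - x) / 2 - Real.sqrt (x ^ 4 - 2 * x ^ 3 + x ^ 2 - 4 * h) / (2 * x)

/-- The first-order Melnikov function of the piecewise-polynomial perturbation of the
Hamiltonian triangle `H(x,y) = x²y(1-x-y)`. -/
noncomputable def Mel (fp fm gp gm : MvPolynomial (Fin 2) ℝ) (h : ℝ) : ℝ :=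
  (∫ x in x0 h..x1 h,
      (MvPolynomial.eval ![x, Yp h x] gp
        - MvPolynomial.eval ![x, Yp h x] fp * deriv (Yp h) x))
    - ∫ x in x0 h..x1 h,
        (MvPolynomial.eval ![x, Ym h x] gm
          - MvPolynomial.eval ![x, Ym h x] fm * deriv (Ym h) x)

section

open Set Filter Topology Polynomial
open scoped ContDiff

/-- `φ` vanishes at `x` to order at least `m`. -/
def Van (φ : ℝ → ℝ) (x : ℝ) (m : ℕ) : Prop := ∀ i < m, iteratedDeriv i φ x = 0

theorem van_zero (φ : ℝ → ℝ) (x : ℝ) : Van φ x 0 := fun _ hi => absurd hi (Nat.not_lt_zero _)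

theorem van_succ {φ : ℝ → ℝ} {x : ℝ} {m : ℕ} :
    Van φ x (m + 1) ↔ φ x = 0 ∧ Van (deriv φ) x m := by
  constructor
  · intro h
    refine ⟨by simpa using h 0 (Nat.succ_pos _), fun i hi => ?_⟩
    rw [← iteratedDeriv_succ']
    exact h (i + 1) (by omega)
  · rintro ⟨h0, h⟩ i hi
    cases i with
    | zero => simpa using h0
    | succ i =>
      rw [iteratedDeriv_succ']
      exact h i (by omega)

theorem Van.mono {φ : ℝ → ℝ} {x : ℝ} {m k : ℕ} (h : Van φ x m) (hk : k ≤ m) : Van φ x k :=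
  fun i hi => h i (hi.trans_le hk)

theorem Van.congr {φ ψ : ℝ → ℝ} {x : ℝ} {m : ℕ} (h : Van φ x m) (he : φ =ᶠ[𝓝 x] ψ) :
    Van ψ x m := fun i hi => by rw [← he.iteratedDeriv_eq i]; exact h i hi

theorem Van.add {φ ψ : ℝ → ℝ} {x : ℝ} {m : ℕ} (hφ : ContDiffAt ℝ ∞ φ x)
    (hψ : ContDiffAt ℝ ∞ ψ x) (h : Van φ x m) (h' : Van ψ x m) : Van (φ + ψ) x m :=
  fun i hi => by
    rw [iteratedDeriv_add (hφ.of_le (by exact_mod_cast le_top))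
      (hψ.of_le (by exact_mod_cast le_top)), h i hi, h' i hi, add_zero]

theorem contDiffAt_deriv {φ : ℝ → ℝ} {x : ℝ} (h : ContDiffAt ℝ ∞ φ x) :
    ContDiffAt ℝ ∞ (deriv φ) x := by
  have h1 : ContDiffAt ℝ ∞ (fderiv ℝ φ) x := h.fderiv_right (by simp)
  exact h1.clm_apply contDiffAt_const

theorem eventually_differentiableAt {φ : ℝ → ℝ} {x : ℝ} (h : ContDiffAt ℝ ∞ φ x) :
    ∀ᶠ y in 𝓝 x, DifferentiableAt ℝ φ y := by
  have h1 : ContDiffAt ℝ 1 φ x := h.of_le (by exact_mod_cast le_top)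
  filter_upwards [h1.eventually (by simp)] with y hy
  exact hy.differentiableAt one_ne_zero

theorem Van.mul {m : ℕ} : ∀ {g φ : ℝ → ℝ} {x : ℝ}, ContDiffAt ℝ ∞ g x → ContDiffAt ℝ ∞ φ x →
    Van φ x m → Van (g * φ) x m := by
  induction m with
  | zero => intros; exact van_zero _ _
  | succ m ih =>
    intro g φ x hg hφ h
    obtain ⟨h0, h1⟩ := van_succ.1 h
    refine van_succ.2 ⟨by simp [h0], ?_⟩
    have : deriv g * φ + g * deriv φ =ᶠ[𝓝 x] deriv (g * φ) := by
      filter_upwards [eventually_differentiableAt hg, eventually_differentiableAt hφ] with y h1 h2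
      simp [deriv_mul h1 h2]
    have hg' := contDiffAt_deriv hg
    have hφ' := contDiffAt_deriv hφ
    exact ((ih hg' hφ (h.mono (Nat.le_succ m))).add (hg'.mul hφ) (hg.mul hφ')
      (ih hg hφ' h1)).congr this

theorem Van.comp {m : ℕ} : ∀ {s φ : ℝ → ℝ} {x : ℝ}, ContDiffAt ℝ ∞ s x →
    ContDiffAt ℝ ∞ φ (s x) → Van φ (s x) m → Van (φ ∘ s) x m := by
  induction m with
  | zero => intros; exact van_zero _ _
  | succ m ih =>
    intro s φ x hs hφ h
    obtain ⟨h0, h1⟩ := van_succ.1 h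
    refine van_succ.2 ⟨by simp [h0], ?_⟩
    have : deriv s * (deriv φ ∘ s) =ᶠ[𝓝 x] deriv (φ ∘ s) := by
      filter_upwards [eventually_differentiableAt hs,
        hs.continuousAt.eventually (eventually_differentiableAt hφ)] with y h1 h2
      rw [deriv_comp y h2 h1]
      simp [mul_comm]
    exact (Van.mul (contDiffAt_deriv hs) ((contDiffAt_deriv hφ).comp x hs)
      (ih hs (contDiffAt_deriv hφ) h1)).congr this

/-- `φ` vanishes identically on `(0, 1)` or has at most `N` zeros there, with multiplicity. -/
def ZB (φ : ℝ → ℝ) (N : ℕ) : Prop :=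
  (∀ x ∈ Ioo (0 : ℝ) 1, φ x = 0) ∨
    ∀ (T : Finset ℝ) (m : ℝ → ℕ), (∀ x ∈ T, x ∈ Ioo (0 : ℝ) 1 ∧ Van φ x (m x)) →
      ∑ x ∈ T, m x ≤ N

theorem ZB.of_ne_zero {φ : ℝ → ℝ} (h : ∀ x ∈ Ioo (0 : ℝ) 1, φ x ≠ 0) (N : ℕ) : ZB φ N := by
  right
  intro T m hT
  have : ∑ x ∈ T, m x = 0 := Finset.sum_eq_zero fun x hx => by
    by_contra hm
    exact h x (hT x hx).1 (by simpa using (hT x hx).2 0 (Nat.pos_of_ne_zero hm))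
  omega

theorem ZB.of_mul {k φ ψ : ℝ → ℝ} {N : ℕ} (hk : ContDiffOn ℝ ∞ k (Ioo 0 1))
    (hk0 : ∀ x ∈ Ioo (0 : ℝ) 1, k x ≠ 0) (hψ : ContDiffOn ℝ ∞ ψ (Ioo 0 1))
    (h : ∀ x ∈ Ioo (0 : ℝ) 1, φ x = k x * ψ x) (hφ : ZB φ N) : ZB ψ N := by
  rcases hφ with h0 | hT
  · left
    intro x hx
    have := h0 x hx
    rw [h x hx] at this
    exact (mul_eq_zero.1 this).resolve_left (hk0 x hx)
  · right
    intro T m hm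
    refine hT T m fun x hx => ⟨(hm x hx).1, ?_⟩
    have hnhds := Ioo_mem_nhds (hm x hx).1.1 (hm x hx).1.2
    refine (Van.mul (hk.contDiffAt hnhds) (hψ.contDiffAt hnhds) (hm x hx).2).congr ?_
    filter_upwards [hnhds] with y hy
    simp [h y hy]

theorem ZB.rolle {φ : ℝ → ℝ} {N : ℕ} (hφ : ContDiffOn ℝ ∞ φ (Ioo 0 1)) (h : ZB (deriv φ) N) :
    ZB φ (N + 1) := by
  classical
  have hdiff : DifferentiableOn ℝ φ (Ioo 0 1) := hφ.differentiableOn (by simp)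
  rcases h with h0 | hT
  · have hc : ∀ x ∈ Ioo (0 : ℝ) 1, φ x = φ (1 / 2) := fun x hx =>
      isOpen_Ioo.is_const_of_deriv_eq_zero isPreconnected_Ioo hdiff
        (fun y hy => h0 y hy) hx (by norm_num)
    by_cases hz : φ (1 / 2) = 0
    · exact Or.inl fun x hx => (hc x hx).trans hz
    · exact ZB.of_ne_zero (fun x hx => by rwa [hc x hx]) _
  · right
    intro T m hm
    set S := T.filter fun x => 0 < m x with hS
    have hSmem : ∀ x ∈ S, x ∈ Ioo (0 : ℝ) 1 ∧ φ x = 0 ∧ Van (deriv φ) x (m x - 1) ∧ 0 < m x := by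
      intro x hx
      obtain ⟨hxT, hx0⟩ := Finset.mem_filter.1 hx
      obtain ⟨k, hk⟩ := Nat.exists_eq_succ_of_ne_zero hx0.ne'
      have := (hm x hxT).2
      rw [hk] at this
      exact ⟨(hm x hxT).1, (van_succ.1 this).1, by rw [hk]; exact (van_succ.1 this).2, hx0⟩
    have hr : ∀ x y : ℝ, ∃ z, x ∈ S → y ∈ S → x < y → z ∈ Ioo x y ∧ deriv φ z = 0 := by
      intro x y
      by_cases hxy : x ∈ S ∧ y ∈ S ∧ x < y
      · obtain ⟨hx, hy, hlt⟩ := hxy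
        obtain ⟨z, hz, hz'⟩ := exists_deriv_eq_zero (f := φ) hlt
          (hφ.continuousOn.mono fun t ht =>
            ⟨(hSmem x hx).1.1.trans_le ht.1, ht.2.trans_lt (hSmem y hy).1.2⟩)
          ((hSmem x hx).2.1.trans (hSmem y hy).2.1.symm)
        exact ⟨z, fun _ _ _ => ⟨hz, hz'⟩⟩
      · exact ⟨0, fun h1 h2 h3 => absurd ⟨h1, h2, h3⟩ hxy⟩
    choose r hr using hr
    set t := ((S ×ˢ S).filter fun p => p.1 < p.2).image fun p => r p.1 p.2 with ht
    have htmem : ∀ z ∈ t, z ∈ Ioo (0 : ℝ) 1 ∧ deriv φ z = 0 := by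
      intro z hz
      obtain ⟨p, hp, rfl⟩ := Finset.mem_image.1 hz
      obtain ⟨hp, hlt⟩ := Finset.mem_filter.1 hp
      obtain ⟨h1, h2⟩ := Finset.mem_product.1 hp
      obtain ⟨h3, h4⟩ := hr _ _ h1 h2 hlt
      exact ⟨⟨(hSmem _ h1).1.1.trans h3.1, h3.2.trans (hSmem _ h2).1.2⟩, h4⟩
    have hcard : S.card ≤ (t \ S).card + 1 := by
      refine Finset.card_le_sdiff_of_interleaved fun x hx y hy hxy _ => ⟨r x y, ?_, ?_⟩
      · exact Finset.mem_image.2 ⟨(x, y), Finset.mem_filter.2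
          ⟨Finset.mem_product.2 ⟨hx, hy⟩, hxy⟩, rfl⟩
      · exact (hr x y hx hy hxy).1
    have key := hT (S ∪ (t \ S)) (fun x => if x ∈ S then m x - 1 else 1) (by
      intro x hx
      by_cases hxS : x ∈ S
      · simpa [hxS] using ⟨(hSmem x hxS).1, (hSmem x hxS).2.2.1⟩
      · have hxt : x ∈ t := by
          rcases Finset.mem_union.1 hx with h | h
          · exact absurd h hxS
          · exact (Finset.mem_sdiff.1 h).1
        simp only [hxS, if_false]
        exact ⟨(htmem x hxt).1, van_succ.2 ⟨(htmem x hxt).2, van_zero _ _⟩⟩)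
    rw [Finset.sum_union Finset.disjoint_sdiff] at key
    have e1 : ∑ x ∈ S, (if x ∈ S then m x - 1 else 1) = ∑ x ∈ S, (m x - 1) :=
      Finset.sum_congr rfl fun x hx => by simp [hx]
    have e2 : ∑ x ∈ t \ S, (if x ∈ S then m x - 1 else 1) = (t \ S).card := by
      rw [Finset.card_eq_sum_ones]
      exact Finset.sum_congr rfl fun x hx => by simp [(Finset.mem_sdiff.1 hx).2]
    have e3 : ∑ x ∈ T, m x = ∑ x ∈ S, m x := by
      rw [hS, Finset.sum_filter]
      refine Finset.sum_congr rfl fun x _ => ?_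
      split_ifs with h <;> omega
    have e4 : ∑ x ∈ S, m x = ∑ x ∈ S, (m x - 1) + S.card := by
      rw [Finset.card_eq_sum_ones, ← Finset.sum_add_distrib]
      refine Finset.sum_congr rfl fun x hx => ?_
      have := (hSmem x hx).2.2.2
      omega
    omega

theorem ZB.of_first_order {φ : ℝ → ℝ} {N : ℕ} (hφ : ContDiffOn ℝ ∞ φ (Ioo 0 1)) {a q : ℝ}
    (ha : 0 ≤ a ∨ a ≤ -1) (h : ZB (fun c => (c + a) * deriv φ c + q * φ c) N) :
    ZB φ (N + 1) := by
  obtain ⟨ε, hε⟩ : ∃ ε : ℝ, ∀ x ∈ Ioo (0 : ℝ) 1, 0 < ε * (x + a) := by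
    rcases ha with ha | ha
    · exact ⟨1, fun x hx => by linarith [hx.1]⟩
    · exact ⟨-1, fun x hx => by linarith [hx.2]⟩
  have hε0 : ε ≠ 0 := fun h0 => by simpa [h0] using hε (1 / 2) (by norm_num)
  have hne : ∀ x ∈ Ioo (0 : ℝ) 1, x + a ≠ 0 := fun x hx h0 => by
    simpa [h0] using hε x hx
  set g : ℝ → ℝ := fun c => (ε * (c + a)) ^ q with hg
  have hgpos : ∀ x ∈ Ioo (0 : ℝ) 1, 0 < g x := fun x hx => Real.rpow_pos_of_pos (hε x hx) _
  have hgs : ContDiffOn ℝ ∞ g (Ioo 0 1) := by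
    refine ContDiffOn.rpow_const_of_ne ?_ fun x hx => (hε x hx).ne'
    fun_prop
  have hψ : ContDiffOn ℝ ∞ (fun c => g c * φ c) (Ioo 0 1) := hgs.mul hφ
  have hd : ∀ x ∈ Ioo (0 : ℝ) 1, HasDerivAt g (q * g x / (x + a)) x := by
    intro x hx
    have h1 : HasDerivAt (fun c => ε * (c + a)) ε x := by
      simpa using ((hasDerivAt_id x).add_const a).const_mul ε
    have h2 := h1.rpow_const (p := q) (Or.inl (hε x hx).ne')
    convert h2 using 1
    rw [Real.rpow_sub_one (hε x hx).ne']
    have := hne x hx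
    simp only [hg]
    field_simp
  have hdφ : ∀ x ∈ Ioo (0 : ℝ) 1, DifferentiableAt ℝ φ x := fun x hx =>
    (hφ.differentiableOn (by simp)).differentiableAt (Ioo_mem_nhds hx.1 hx.2)
  have hψd : ContDiffOn ℝ ∞ (deriv fun c => g c * φ c) (Ioo 0 1) :=
    fun x hx => (contDiffAt_deriv (hψ.contDiffAt (Ioo_mem_nhds hx.1 hx.2))).contDiffWithinAt
  have h1 : ZB (deriv fun c => g c * φ c) N := by
    refine ZB.of_mul (k := fun c => (c + a) / g c) ?_ ?_ hψd ?_ h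
    · exact ContDiffOn.div (by fun_prop) hgs fun x hx => (hgpos x hx).ne'
    · exact fun x hx => div_ne_zero (hne x hx) (hgpos x hx).ne'
    · intro x hx
      have := ((hd x hx).mul (hdφ x hx).hasDerivAt).deriv
      change deriv (fun c => g c * φ c) x = _ at this
      rw [this]
      have h1 := hne x hx
      have h2 := (hgpos x hx).ne'
      field_simp
      ring
  have h2 := ZB.rolle hψ h1
  exact ZB.of_mul hgs (fun x hx => (hgpos x hx).ne') hφ (fun x _ => rfl) h2

/-- Smooth functions on `(0, 1)`, extended by zero. -/
def Sm : Submodule ℝ (ℝ → ℝ) where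
  carrier := {f | ContDiffOn ℝ ∞ f (Ioo 0 1) ∧ ∀ x ∉ Ioo (0 : ℝ) 1, f x = 0}
  add_mem' := fun ha hb => ⟨ha.1.add hb.1, fun x hx => by simp [ha.2 x hx, hb.2 x hx]⟩
  zero_mem' := ⟨contDiffOn_const, fun _ _ => rfl⟩
  smul_mem' := fun r f hf => ⟨contDiffOn_const.smul hf.1, fun x hx => by simp [hf.2 x hx]⟩

namespace Sm

theorem smooth (f : Sm) : ContDiffOn ℝ ∞ f.1 (Ioo 0 1) := f.2.1

theorem differentiableAt (f : Sm) {x : ℝ} (hx : x ∈ Ioo (0 : ℝ) 1) : DifferentiableAt ℝ f.1 x :=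
  ((smooth f).differentiableOn (by simp)).differentiableAt (Ioo_mem_nhds hx.1 hx.2)

theorem ext' {f g : Sm} (h : ∀ x ∈ Ioo (0 : ℝ) 1, f.1 x = g.1 x) : f = g := by
  refine Subtype.ext (funext fun x => ?_)
  by_cases hx : x ∈ Ioo (0 : ℝ) 1
  · exact h x hx
  · rw [f.2.2 x hx, g.2.2 x hx]

open Classical in
/-- The element of `Sm` given by a function on `ℝ`; zero if it is not smooth on `(0, 1)`. -/
noncomputable def ofFun (φ : ℝ → ℝ) : Sm :=
  if h : ContDiffOn ℝ ∞ φ (Ioo 0 1) then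
    ⟨(Ioo 0 1).indicator φ, h.congr fun x hx => by simp [indicator_of_mem hx],
      fun x hx => by simp [indicator_of_notMem hx]⟩
  else 0

theorem ofFun_apply {φ : ℝ → ℝ} (h : ContDiffOn ℝ ∞ φ (Ioo 0 1)) {x : ℝ}
    (hx : x ∈ Ioo (0 : ℝ) 1) : (ofFun φ).1 x = φ x := by
  rw [ofFun, dif_pos h]
  exact indicator_of_mem hx _

theorem smooth_deriv (f : Sm) : ContDiffOn ℝ ∞ (deriv f.1) (Ioo 0 1) := fun _ hx =>
  (contDiffAt_deriv ((smooth f).contDiffAt (Ioo_mem_nhds hx.1 hx.2))).contDiffWithinAt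

/-- Differentiation. -/
noncomputable def D : Module.End ℝ Sm where
  toFun f := ofFun (deriv f.1)
  map_add' f g := ext' fun x hx => by
    have e := deriv_add (differentiableAt f hx) (differentiableAt g hx)
    rw [ofFun_apply (smooth_deriv (f + g)) hx]
    simp only [Submodule.coe_add, Pi.add_apply]
    rw [ofFun_apply (smooth_deriv f) hx, ofFun_apply (smooth_deriv g) hx]
    exact e
  map_smul' r f := ext' fun x hx => by
    rw [ofFun_apply (smooth_deriv (r • f)) hx]
    simp only [Submodule.coe_smul, Pi.smul_apply, RingHom.id_apply]
    rw [ofFun_apply (smooth_deriv f) hx]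
    exact deriv_const_smul r (differentiableAt f hx)

theorem D_apply (f : Sm) {x : ℝ} (hx : x ∈ Ioo (0 : ℝ) 1) : (D f).1 x = deriv f.1 x :=
  ofFun_apply (smooth_deriv f) hx

/-- Multiplication by the variable. -/
noncomputable def mulX : Module.End ℝ Sm where
  toFun f := ⟨fun x => x * f.1 x, contDiffOn_id.mul (smooth f), fun x hx => by simp [f.2.2 x hx]⟩
  map_add' f g := Subtype.ext (funext fun x => by simp [mul_add])
  map_smul' r f := Subtype.ext (funext fun x => by simp; ring)

theorem mulX_apply (f : Sm) (x : ℝ) : (mulX f).1 x = x * f.1 x := rfl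

/-- The Euler operator. -/
noncomputable def theta : Module.End ℝ Sm := mulX * D

theorem theta_apply (f : Sm) : theta f = mulX (D f) := rfl

theorem D_ofFun {φ φ' : ℝ → ℝ} (h : ContDiffOn ℝ ∞ φ (Ioo 0 1))
    (hd : ∀ x ∈ Ioo (0 : ℝ) 1, HasDerivAt φ (φ' x) x) : D (ofFun φ) = ofFun φ' := by
  have h' : ContDiffOn ℝ ∞ φ' (Ioo 0 1) := by
    have : ContDiffOn ℝ ∞ (deriv φ) (Ioo 0 1) := fun x hx =>
      (contDiffAt_deriv (h.contDiffAt (Ioo_mem_nhds hx.1 hx.2))).contDiffWithinAt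
    exact this.congr fun x hx => (hd x hx).deriv.symm
  refine ext' fun x hx => ?_
  rw [D_apply _ hx, ofFun_apply h' hx, ← (hd x hx).deriv]
  refine Filter.EventuallyEq.deriv_eq ?_
  filter_upwards [Ioo_mem_nhds hx.1 hx.2] with y hy
  exact ofFun_apply h hy

/-- The first order operator `φ ↦ (c + a) φ' + q φ`. -/
noncomputable def R (a q : ℝ) : Module.End ℝ Sm := mulX * D + a • D + q • 1

theorem R_apply (a q : ℝ) (f : Sm) : R a q f = mulX (D f) + a • D f + q • f := rfl

theorem zb_of_R {a q : ℝ} (ha : 0 ≤ a ∨ a ≤ -1) {f : Sm} {N : ℕ} (h : ZB (R a q f).1 N) :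
    ZB f.1 (N + 1) := by
  refine ZB.of_first_order (q := q) (smooth f) ha ?_
  refine ZB.of_mul (k := fun _ => 1) contDiffOn_const (fun _ _ => one_ne_zero) ?_ ?_ h
  · refine ContDiffOn.add (ContDiffOn.mul (by fun_prop) (smooth_deriv f))
      (contDiffOn_const.mul (smooth f))
  · intro x hx
    change x * (D f).1 x + a * (D f).1 x + q * f.1 x = _
    rw [D_apply _ hx]
    ring

theorem zb_of_aeval_theta {ι : Type*} (s : Finset ι) (l : ι → ℝ) : ∀ {f : Sm} {N : ℕ},
    ZB (Polynomial.aeval theta (∏ i ∈ s, (Polynomial.X - Polynomial.C (l i))) f).1 N →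
    ZB f.1 (N + s.card) := by
  classical
  induction s using Finset.induction_on with
  | empty => intro f N h; simpa using h
  | insert i s hi ih =>
    intro f N h
    rw [Finset.prod_insert hi, mul_comm, map_mul] at h
    have h1 := ih h
    have h2 : Polynomial.aeval theta (Polynomial.X - Polynomial.C (l i)) f = R 0 (-l i) f := by
      simp [R_apply, theta_apply, sub_eq_add_neg, Algebra.algebraMap_eq_smul_one]
      exact (neg_smul (l i) f).symm
    rw [h2] at h1
    rw [Finset.card_insert_of_notMem hi, ← add_assoc]
    exact zb_of_R (Or.inl le_rfl) h1

end Sm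

theorem contDiffOn_partialDeriv {F : ℝ × ℝ → ℝ} (hF : ContDiffOn ℝ ∞ F (Ioo (0 : ℝ) 1 ×ˢ univ)) :
    ContDiffOn ℝ ∞ (fun p : ℝ × ℝ => deriv (fun c => F (c, p.2)) p.1) (Ioo (0 : ℝ) 1 ×ˢ univ) ∧
    ∀ c ∈ Ioo (0 : ℝ) 1, ∀ t, HasDerivAt (fun c => F (c, t)) (deriv (fun c => F (c, t)) c) c := by
  have hopen : IsOpen (Ioo (0 : ℝ) 1 ×ˢ (univ : Set ℝ)) := isOpen_Ioo.prod isOpen_univ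
  have hd : ∀ c ∈ Ioo (0 : ℝ) 1, ∀ t,
      HasDerivAt (fun c => F (c, t)) (fderiv ℝ F (c, t) (1, 0)) c := by
    intro c hc t
    have h1 : HasFDerivAt F (fderiv ℝ F (c, t)) (c, t) :=
      ((hF.contDiffAt (hopen.mem_nhds ⟨hc, mem_univ _⟩)).differentiableAt (by simp)).hasFDerivAt
    exact h1.comp_hasDerivAt c ((hasDerivAt_id c).prodMk (hasDerivAt_const c t))
  refine ⟨?_, fun c hc t => (hd c hc t).differentiableAt.hasDerivAt⟩
  have h2 : ContDiffOn ℝ ∞ (fun p => fderiv ℝ F p (1, 0)) (Ioo (0 : ℝ) 1 ×ˢ univ) :=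
    (hF.fderiv_of_isOpen hopen (by simp)).clm_apply contDiffOn_const
  exact h2.congr fun p hp => (hd p.1 hp.1 p.2).deriv

open MeasureTheory in
theorem hasDerivAt_integral_param {F : ℝ × ℝ → ℝ}
    (hF : ContDiffOn ℝ ∞ F (Ioo (0 : ℝ) 1 ×ˢ univ)) (a b : ℝ) {c : ℝ} (hc : c ∈ Ioo (0 : ℝ) 1) :
    HasDerivAt (fun c => ∫ t in a..b, F (c, t)) (∫ t in a..b, deriv (fun c => F (c, t)) c) c := by
  obtain ⟨h1, h2⟩ := contDiffOn_partialDeriv hF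
  obtain ⟨ε, hε, hball⟩ := Metric.nhds_basis_closedBall.mem_iff.1 (Ioo_mem_nhds hc.1 hc.2)
  have hcont : ∀ {G : ℝ × ℝ → ℝ}, ContinuousOn G (Ioo (0 : ℝ) 1 ×ˢ univ) →
      ∀ c ∈ Ioo (0 : ℝ) 1, Continuous fun t => G (c, t) := fun hG c hc => by
    rw [← continuousOn_univ]
    exact hG.comp (by fun_prop) fun t _ => ⟨hc, mem_univ _⟩
  obtain ⟨C, hC⟩ := ((isCompact_closedBall c ε).prod (isCompact_uIcc (a := a) (b := b))
    ).exists_bound_of_continuousOn (h1.continuousOn.mono (prod_mono hball (subset_univ _)))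
  refine (intervalIntegral.hasDerivAt_integral_of_dominated_loc_of_deriv_le
    (F := fun c t => F (c, t)) (F' := fun c t => deriv (fun c => F (c, t)) c) (bound := fun _ => C)
    (Metric.closedBall_mem_nhds c hε) ?_ ?_ ?_ ?_ ?_ ?_).2
  · filter_upwards [Ioo_mem_nhds hc.1 hc.2] with y hy
    exact (hcont hF.continuousOn y hy).aestronglyMeasurable
  · exact (hcont hF.continuousOn c hc).intervalIntegrable _ _
  · exact (hcont h1.continuousOn c hc).aestronglyMeasurable
  · exact ae_of_all _ fun t ht y hy => hC (y, t) ⟨hy, uIoc_subset_uIcc ht⟩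
  · exact intervalIntegrable_const
  · exact ae_of_all _ fun t _ y hy => h2 y (hball hy) t

theorem contDiffOn_integral_param {F : ℝ × ℝ → ℝ}
    (hF : ContDiffOn ℝ ∞ F (Ioo (0 : ℝ) 1 ×ˢ univ)) (a b : ℝ) :
    ContDiffOn ℝ ∞ (fun c => ∫ t in a..b, F (c, t)) (Ioo 0 1) := by
  rw [contDiffOn_infty]
  intro n
  induction n generalizing F with
  | zero =>
    exact contDiffOn_zero.2 fun c hc =>
      (hasDerivAt_integral_param hF a b hc).continuousAt.continuousWithinAt
  | succ n ih =>
    push_cast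
    rw [contDiffOn_succ_iff_deriv_of_isOpen isOpen_Ioo]
    refine ⟨fun c hc => (hasDerivAt_integral_param hF a b hc).differentiableAt.differentiableWithinAt,
      by simp, ?_⟩
    exact (ih (contDiffOn_partialDeriv hF).1).congr fun c hc =>
      (hasDerivAt_integral_param hF a b hc).deriv

/-- The weight `(1 + sin² α)^(-1/2)`. -/
noncomputable def wt (t : ℝ) : ℝ := (√(1 + Real.sin t ^ 2))⁻¹

/-- The node `cos² α / (1 + sin² α)`. -/
noncomputable def nd (t : ℝ) : ℝ := 2 * wt t ^ 2 - 1

theorem wt_pos (t : ℝ) : 0 < wt t := inv_pos.2 (Real.sqrt_pos.2 (by positivity))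

theorem wt_sq (t : ℝ) : wt t ^ 2 * (1 + Real.sin t ^ 2) = 1 := by
  have h : (0 : ℝ) < 1 + Real.sin t ^ 2 := by positivity
  rw [wt, inv_pow, Real.sq_sqrt h.le]
  field_simp

theorem nd_eq (t : ℝ) : nd t = Real.cos t ^ 2 * wt t ^ 2 := by
  rw [nd, Real.cos_sq']
  linear_combination wt_sq t

theorem nd_nonneg (t : ℝ) : 0 ≤ nd t := by rw [nd_eq]; positivity

theorem nd_le_one (t : ℝ) : nd t ≤ 1 := by
  have h1 := wt_sq t
  have h2 : 0 ≤ wt t ^ 2 * Real.sin t ^ 2 := by positivity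
  rw [nd]
  linarith

theorem contDiff_wt : ContDiff ℝ ∞ wt := by
  unfold wt
  refine ContDiff.inv (ContDiff.sqrt (by fun_prop) fun t => ?_) fun t => ?_
  · positivity
  · exact (Real.sqrt_pos.2 (by positivity)).ne'

theorem contDiff_nd : ContDiff ℝ ∞ nd := by
  unfold nd
  exact (contDiff_const.mul (contDiff_wt.pow 2)).sub contDiff_const

theorem hasDerivAt_wt (t : ℝ) : HasDerivAt wt (-(Real.sin t * Real.cos t * wt t ^ 3)) t := by
  have hw := wt_pos t
  have h1 : HasDerivAt (fun t => wt t ^ 2 * (1 + Real.sin t ^ 2)) 0 t := by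
    simp only [wt_sq]; exact hasDerivAt_const t 1
  have h2 : HasDerivAt wt (deriv wt t) t :=
    ((contDiff_wt.differentiable (by simp)) t).hasDerivAt
  have h3 := ((h2.pow 2).mul (((Real.hasDerivAt_sin t).pow 2).const_add 1)).unique h1
  simp only [Pi.pow_apply] at h3
  have h4 := wt_sq t
  have : deriv wt t = -(Real.sin t * Real.cos t * wt t ^ 3) := by
    have h5 : wt t * deriv wt t * (1 + Real.sin t ^ 2) = -(wt t ^ 2 * Real.sin t * Real.cos t) := by
      push_cast at h3
      linear_combination h3 / 2
    have h6 : wt t * (deriv wt t + Real.sin t * Real.cos t * wt t ^ 3) = 0 := by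
      linear_combination wt t ^ 2 * h5 - wt t * deriv wt t * h4
    have := (mul_eq_zero.1 h6).resolve_left hw.ne'
    linarith
  rwa [this] at h2

theorem hasDerivAt_nd (t : ℝ) : HasDerivAt nd (-(4 * Real.sin t * Real.cos t * wt t ^ 4)) t := by
  have := (((hasDerivAt_wt t).pow 2).const_mul 2).sub_const 1
  refine this.congr_deriv ?_
  push_cast
  ring

theorem contDiffOn_lamIntegrand (q : ℝ) (g : ℝ[X]) :
    ContDiffOn ℝ ∞ (fun p : ℝ × ℝ => g.eval (nd p.2) * wt p.2 * (p.1 + nd p.2) ^ (-q))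
      (Ioo (0 : ℝ) 1 ×ˢ univ) := by
  have h1 : ContDiff ℝ ∞ fun p : ℝ × ℝ => nd p.2 := contDiff_nd.comp contDiff_snd
  refine ContDiffOn.mul (ContDiff.contDiffOn ?_) ?_
  · exact ((Polynomial.contDiff_aeval g ∞).comp h1).mul (contDiff_wt.comp contDiff_snd)
  · refine ContDiffOn.rpow_const_of_ne (contDiff_fst.add h1).contDiffOn fun p hp => ?_
    have := nd_nonneg p.2
    have := hp.1.1
    positivity

theorem continuous_lamIntegrand (q : ℝ) (g : ℝ[X]) {c : ℝ} (hc : 0 < c) :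
    Continuous fun t => g.eval (nd t) * wt t * (c + nd t) ^ (-q) := by
  have h1 := contDiff_nd.continuous
  have h2 := contDiff_wt.continuous
  refine Continuous.mul ((g.continuous.comp h1).mul h2) ?_
  refine (continuous_const.add h1).rpow_const fun t => Or.inl ?_
  exact (add_pos_of_pos_of_nonneg hc (nd_nonneg t)).ne'

/-- The integral `∫ g(y) w (c + y)^(-q)`. -/
noncomputable def lamFun (q : ℝ) (g : ℝ[X]) (c : ℝ) : ℝ :=
  ∫ t in (-(Real.pi / 2))..(Real.pi / 2), g.eval (nd t) * wt t * (c + nd t) ^ (-q)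

theorem contDiffOn_lamFun (q : ℝ) (g : ℝ[X]) : ContDiffOn ℝ ∞ (lamFun q g) (Ioo 0 1) :=
  contDiffOn_integral_param (contDiffOn_lamIntegrand q g) _ _

namespace Sm

/-- The integrals `lamFun` as a linear map in the polynomial weight. -/
noncomputable def lam0 (q : ℝ) : ℝ[X] →ₗ[ℝ] Sm where
  toFun g := ofFun (lamFun q g)
  map_add' g g' := ext' fun c hc => by
    change _ = (ofFun _).1 c + (ofFun _).1 c
    rw [ofFun_apply (contDiffOn_lamFun _ _) hc, ofFun_apply (contDiffOn_lamFun _ _) hc,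
      ofFun_apply (contDiffOn_lamFun _ _) hc, lamFun, lamFun, lamFun,
      ← intervalIntegral.integral_add]
    · simp only [eval_add, add_mul]
    · exact (continuous_lamIntegrand q g hc.1).intervalIntegrable _ _
    · exact (continuous_lamIntegrand q g' hc.1).intervalIntegrable _ _
  map_smul' r g := ext' fun c hc => by
    change _ = r * (ofFun _).1 c
    rw [ofFun_apply (contDiffOn_lamFun _ _) hc, ofFun_apply (contDiffOn_lamFun _ _) hc,
      lamFun, lamFun, ← intervalIntegral.integral_const_mul]
    simp only [eval_smul, smul_eq_mul, mul_assoc]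

theorem lam0_apply (q : ℝ) (g : ℝ[X]) {c : ℝ} (hc : c ∈ Ioo (0 : ℝ) 1) :
    (lam0 q g).1 c = lamFun q g c := ofFun_apply (contDiffOn_lamFun _ _) hc

theorem D_lam0 (q : ℝ) (g : ℝ[X]) : D (lam0 q g) = -q • lam0 (q + 1) g := by
  refine ext' fun c hc => ?_
  rw [D_apply _ hc]
  change _ = -q * (lam0 (q + 1) g).1 c
  rw [lam0_apply _ _ hc, lamFun, ← intervalIntegral.integral_const_mul]
  have h1 : deriv (lam0 q g).1 c = deriv (lamFun q g) c := by
    refine Filter.EventuallyEq.deriv_eq ?_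
    filter_upwards [Ioo_mem_nhds hc.1 hc.2] with y hy
    exact lam0_apply q g hy
  rw [h1]
  refine (hasDerivAt_integral_param (contDiffOn_lamIntegrand q g) _ _ hc).deriv.trans ?_
  refine intervalIntegral.integral_congr fun t _ => ?_
  have hpos : c + nd t ≠ 0 := by
    have := nd_nonneg t
    have := hc.1
    positivity
  have h2 := (((hasDerivAt_id c).add_const (nd t)).rpow_const (p := -q) (Or.inl hpos)).const_mul
    (g.eval (nd t) * wt t)
  refine h2.deriv.trans ?_
  simp only [id]
  rw [show -(q + 1) = -q - 1 by ring]
  ring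

theorem mulX_lam0 (q : ℝ) (g : ℝ[X]) :
    mulX (lam0 (q + 1) g) + lam0 (q + 1) (X * g) = lam0 q g := by
  refine ext' fun c hc => ?_
  change c * (lam0 (q + 1) g).1 c + (lam0 (q + 1) (X * g)).1 c = _
  rw [lam0_apply _ _ hc, lam0_apply _ _ hc, lam0_apply _ _ hc, lamFun, lamFun, lamFun,
    ← intervalIntegral.integral_const_mul, ← intervalIntegral.integral_add]
  · refine intervalIntegral.integral_congr fun t _ => ?_
    have hpos : c + nd t ≠ 0 := by
      have := nd_nonneg t
      have := hc.1
      positivity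
    simp only [eval_mul, eval_X]
    rw [show -q = -(q + 1) + 1 by ring, Real.rpow_add_one hpos]
    ring
  · exact (continuous_const.mul (continuous_lamIntegrand (q + 1) g hc.1)).intervalIntegrable _ _
  · exact (continuous_lamIntegrand (q + 1) _ hc.1).intervalIntegrable _ _

theorem lam0_byParts (q : ℝ) (K : ℝ[X]) :
    q • lam0 (q + 1) ((1 - X ^ 2) * X * K) =
      lam0 q ((1 - X ^ 2) * (X * derivative K + C (1 / 2) * K) - X ^ 2 * K) := by
  refine ext' fun c hc => ?_
  change q * (lam0 (q + 1) _).1 c = _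
  rw [lam0_apply _ _ hc, lam0_apply _ _ hc, lamFun, lamFun,
    ← intervalIntegral.integral_const_mul, ← sub_eq_zero, ← intervalIntegral.integral_sub]
  · have hd : ∀ t ∈ uIcc (-(Real.pi / 2)) (Real.pi / 2),
        HasDerivAt (fun t => (Real.sin t * Real.cos t * wt t ^ 3) *
          (K.eval (nd t) * (c + nd t) ^ (-q)))
          (q * (((1 - X ^ 2) * X * K).eval (nd t) * wt t * (c + nd t) ^ (-(q + 1))) -
            ((1 - X ^ 2) * (X * derivative K + C (1 / 2) * K) - X ^ 2 * K).eval (nd t) * wt t *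
              (c + nd t) ^ (-q)) t := by
      intro t _
      have hpos : c + nd t ≠ 0 := by
        have := nd_nonneg t
        have := hc.1
        positivity
      have h1 := (((Real.hasDerivAt_sin t).mul (Real.hasDerivAt_cos t)).mul
        ((hasDerivAt_wt t).pow 3)).mul
        (((K.hasDerivAt (nd t)).comp t (hasDerivAt_nd t)).mul
          (((hasDerivAt_nd t).const_add c).rpow_const (p := -q) (Or.inl hpos)))
      refine h1.congr_deriv ?_
      have hs : wt t ^ 2 * Real.sin t ^ 2 = 1 - wt t ^ 2 := by linear_combination wt_sq t
      have hcs : wt t ^ 2 * Real.cos t ^ 2 = 2 * wt t ^ 2 - 1 := by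
        rw [Real.cos_sq']; linear_combination -wt_sq t
      simp only [eval_mul, eval_sub, eval_add, eval_pow, eval_X, eval_one, eval_C, Pi.mul_apply,
        Pi.pow_apply, Function.comp]
      rw [show -(q + 1) = -q - 1 by ring]
      generalize (c + nd t) ^ (-q) = A
      generalize (c + nd t) ^ (-q - 1) = B
      generalize eval (nd t) (derivative K) = K'
      generalize eval (nd t) K = K0
      simp only [nd]
      generalize wt t = w at *
      generalize Real.sin t = s at *
      generalize Real.cos t = k at *
      push_cast
      have hsc : w ^ 4 * (s ^ 2 * k ^ 2) = (1 - w ^ 2) * (2 * w ^ 2 - 1) := by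
        linear_combination w ^ 2 * k ^ 2 * hs + (1 - w ^ 2) * hcs
      linear_combination (w * K0 * A) * (hcs - hs) - (3 * w * K0 * A) * hsc
        - (4 * w ^ 3 * K' * A) * hsc + (4 * q * w ^ 3 * K0 * B) * hsc
    rw [intervalIntegral.integral_eq_sub_of_hasDerivAt hd]
    · simp
    · refine Continuous.intervalIntegrable ?_ _ _
      exact (continuous_const.mul (continuous_lamIntegrand (q + 1) _ hc.1)).sub
        (continuous_lamIntegrand q _ hc.1)
  · exact (continuous_const.mul (continuous_lamIntegrand (q + 1) _ hc.1)).intervalIntegrable _ _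
  · exact (continuous_lamIntegrand q _ hc.1).intervalIntegrable _ _

end Sm

namespace Sm

/-- The operator `g ↦ -(X g' + (1/2 + a) g)` on polynomials. -/
noncomputable def eulerOp (a : ℝ) : ℝ[X] →ₗ[ℝ] ℝ[X] :=
  -(LinearMap.mulLeft ℝ X ∘ₗ derivative) - (1 / 2 + a) • LinearMap.id

theorem eulerOp_apply (a : ℝ) (g : ℝ[X]) :
    eulerOp a g = -(X * derivative g) - C (1 / 2 + a) * g := by
  rw [C_mul']; simp [eulerOp]

/-- The iterates of `lam0` under `θ - a₀, θ - a₁, …`. -/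
noncomputable def lam (a : ℕ → ℝ) : ℕ → ℝ → ℝ[X] →ₗ[ℝ] Sm
  | 0, q => lam0 q
  | i + 1, q => lam a i q ∘ₗ eulerOp (a i) + q • (lam a i (q + 1) ∘ₗ LinearMap.mulLeft ℝ X)

theorem lam_zero (a : ℕ → ℝ) (q : ℝ) : lam a 0 q = lam0 q := rfl

theorem lam_succ (a : ℕ → ℝ) (i : ℕ) (q : ℝ) (g : ℝ[X]) :
    lam a (i + 1) q g = lam a i q (eulerOp (a i) g) + q • lam a i (q + 1) (X * g) := rfl

theorem D_lam (a : ℕ → ℝ) (i : ℕ) (q : ℝ) (g : ℝ[X]) :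
    D (lam a i q g) = -q • lam a i (q + 1) g := by
  induction i generalizing q g with
  | zero => exact D_lam0 q g
  | succ i ih =>
    rw [lam_succ, lam_succ, map_add, map_smul, ih, ih]
    module

theorem mulX_lam (a : ℕ → ℝ) (i : ℕ) (q : ℝ) (g : ℝ[X]) :
    mulX (lam a i (q + 1) g) + lam a i (q + 1) (X * g) = lam a i q g := by
  induction i generalizing q g with
  | zero => exact mulX_lam0 q g
  | succ i ih =>
    have h1 : eulerOp (a i) (X * g) = X * eulerOp (a i) g - X * g := by
      simp only [eulerOp_apply, derivative_mul, derivative_X]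
      ring
    rw [lam_succ, lam_succ, lam_succ, h1, map_add, map_smul, map_sub, ← ih q (eulerOp (a i) g),
      ← ih (q + 1) (X * g)]
    module

theorem R_lam (a : ℕ → ℝ) (i : ℕ) (b q : ℝ) (g : ℝ[X]) :
    R b q (lam a i q g) = q • lam a i (q + 1) ((X - C b) * g) := by
  have h := mulX_lam a i q g
  rw [R_apply, D_lam, sub_mul, map_sub, C_mul', map_smul, map_smul]
  rw [← h]
  module

theorem theta_lam (a : ℕ → ℝ) (i : ℕ) :
    theta (lam a i (1 / 2) 1) - a i • lam a i (1 / 2) 1 = lam a (i + 1) (1 / 2) 1 := by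
  have h := mulX_lam a i (1 / 2) 1
  have h2 : eulerOp (a i) 1 = (-(1 / 2 + a i)) • (1 : ℝ[X]) := by
    rw [eulerOp_apply, ← C_mul', C_neg]; simp
  rw [theta_apply, D_lam, lam_succ, h2, map_smul, map_smul, ← h]
  module

/-- The polynomials arising when `lam` is reduced to `lam0` by parts. -/
noncomputable def redPoly (a : ℕ → ℝ) : ℕ → ℝ[X]
  | 0 => 1
  | i + 1 => 2 * X * (1 - X) * derivative (redPoly a i) + (2 * (i : ℝ[X]) + 1) * X * redPoly a i
      - C (a i) * (1 - X) * redPoly a i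

theorem redPoly_succ (a : ℕ → ℝ) (i : ℕ) : redPoly a (i + 1) =
    2 * X * (1 - X) * derivative (redPoly a i) + (2 * (i : ℝ[X]) + 1) * X * redPoly a i
      - C (a i) * (1 - X) * redPoly a i := rfl

theorem lam_reduce (a : ℕ → ℝ) (i k : ℕ) (q : ℝ) (g : ℝ[X]) :
    lam a i q ((1 - X ^ 2) ^ (k + i) * g) =
      lam0 q ((1 - X ^ 2) ^ k * (redPoly a i).comp (X ^ 2) * g) := by
  induction i generalizing q g k with
  | zero => simp [lam_zero, redPoly]
  | succ i ih =>
    have h1 : eulerOp (a i) ((1 - X ^ 2) ^ (k + (i + 1)) * g) = (1 - X ^ 2) ^ (k + i) *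
        (2 * ((k : ℝ[X]) + (i : ℝ[X]) + 1) * X ^ 2 * g - X * (1 - X ^ 2) * derivative g
          - C (1 / 2 + a i) * (1 - X ^ 2) * g) := by
      rw [← add_assoc, eulerOp_apply, derivative_mul, derivative_pow_succ]
      simp only [derivative_sub, derivative_one, derivative_X_pow]
      push_cast
      simp only [map_add, map_natCast, map_one, map_ofNat]
      ring
    have h2 : X * ((1 - X ^ 2) ^ (k + (i + 1)) * g) = (1 - X ^ 2) ^ (k + 1 + i) * (X * g) := by
      ring
    rw [lam_succ, h1, h2, ih, ih]
    have h3 := lam0_byParts q ((1 - X ^ 2) ^ k * (redPoly a i).comp (X ^ 2) * g)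
    have h4 : (1 - X ^ 2) ^ (k + 1) * (redPoly a i).comp (X ^ 2) * (X * g) =
      (1 - X ^ 2) * X * ((1 - X ^ 2) ^ k * (redPoly a i).comp (X ^ 2) * g) := by ring
    rw [h4, h3, ← map_add]
    congr 1
    have h5 : (1 - X ^ 2) * derivative ((1 - X ^ 2 : ℝ[X]) ^ k) =
        -(2 * (k : ℝ[X]) * X * (1 - X ^ 2) ^ k) := by
      cases k with
      | zero => simp
      | succ k =>
        rw [derivative_pow_succ]
        simp only [derivative_sub, derivative_one, derivative_X_pow]
        push_cast
        simp only [map_add, map_natCast, map_one, map_ofNat]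
        ring
    rw [redPoly_succ]
    simp only [derivative_mul, derivative_comp, derivative_X_pow, sub_comp, add_comp, mul_comp,
      one_comp, X_comp, C_comp, natCast_comp, ofNat_comp, C_add]
    simp only [Nat.cast_ofNat, map_ofNat, Nat.reduceSub, pow_one]
    linear_combination (X * (redPoly a i).comp (X ^ 2) * g) * h5

theorem natDegree_redPoly (a : ℕ → ℝ) (i : ℕ) : (redPoly a i).natDegree ≤ i := by
  induction i with
  | zero => simp [redPoly]
  | succ i ih =>
    have hX : (1 - X : ℝ[X]).natDegree ≤ 1 := by compute_degree
    have h2X : (2 * X : ℝ[X]).natDegree ≤ 1 := by compute_degree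
    have hi : ((2 * (i : ℝ[X]) + 1) * X).natDegree ≤ 1 := by
      rw [show (2 * (i : ℝ[X]) + 1) = C (2 * (i : ℝ) + 1) by simp [map_ofNat]]
      compute_degree
    have hC : (C (a i) * (1 - X) : ℝ[X]).natDegree ≤ 1 := by compute_degree
    rw [redPoly_succ]
    refine (natDegree_sub_le_of_le (natDegree_add_le_of_degree_le (n := i + 1) ?_ ?_)
      (n := i + 1) ?_).trans (max_self _).le
    · by_cases h0 : i = 0
      · subst h0; simp [redPoly]
      · have h3 := natDegree_derivative_le (redPoly a i)
        have := natDegree_mul_le_of_le (natDegree_mul_le_of_le h2X hX) h3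
        omega
    · have := natDegree_mul_le_of_le hi ih
      omega
    · have := natDegree_mul_le_of_le hC ih
      omega

theorem X_pow_dvd_redPoly {a : ℕ → ℝ} {N : ℕ} (h1 : ∀ i ≤ N, a i = 2 * i)
    (h2 : ∀ i, N < i → a i = 0) (i : ℕ) : X ^ min i (N + 1) ∣ redPoly a i := by
  induction i with
  | zero => simp
  | succ i ih =>
    obtain ⟨Q, hQ⟩ := ih
    by_cases hi : i ≤ N
    · rw [min_eq_left (by omega)] at hQ
      rw [min_eq_left (by omega)]
      refine ⟨2 * (1 - X : ℝ[X]) * derivative Q + (2 * (i : ℝ[X]) + 1) * Q, ?_⟩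
      have hd : X * derivative (X ^ i * Q) = (i : ℝ[X]) * X ^ i * Q + X ^ (i + 1) * derivative Q := by
        cases i with
        | zero => simp
        | succ i =>
          rw [derivative_mul, derivative_X_pow]
          simp only [map_natCast, Nat.add_sub_cancel]
          ring
      rw [redPoly_succ, hQ, h1 i hi]
      simp only [map_mul, map_natCast, map_ofNat]
      linear_combination 2 * (1 - X) * hd
    · rw [min_eq_right (by omega)] at hQ
      rw [min_eq_right (by omega)]
      refine ⟨2 * (1 - X : ℝ[X]) * (((N + 1 : ℕ) : ℝ[X]) * Q + X * derivative Q) +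
        (2 * (i : ℝ[X]) + 1) * X * Q, ?_⟩
      rw [redPoly_succ, hQ, h2 i (by omega), derivative_mul, derivative_X_pow]
      simp only [map_natCast, map_zero, Nat.add_sub_cancel]
      ring

end Sm

theorem exists_nd_eq {y : ℝ} (hy : y ∈ Icc (0 : ℝ) 1) :
    ∃ t ∈ Icc (-(Real.pi / 2)) (Real.pi / 2), nd t = y := by
  have hpi := Real.pi_pos
  have h0 : nd 0 = 1 := by simp [nd, wt]; norm_num
  have h1 : nd (Real.pi / 2) = 0 := by rw [nd_eq]; simp
  have h := intermediate_value_Icc' (f := nd) (a := 0) (b := Real.pi / 2) (by positivity)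
    contDiff_nd.continuous.continuousOn
  rw [h0, h1] at h
  obtain ⟨t, ht, rfl⟩ := h hy
  exact ⟨t, ⟨by linarith [ht.1], ht.2⟩, rfl⟩

theorem lamFun_pos {q : ℝ} {G : ℝ[X]} (hG : G ≠ 0) (hpos : ∀ y ∈ Icc (0 : ℝ) 1, 0 ≤ G.eval y)
    {c : ℝ} (hc : 0 < c) : 0 < lamFun q G c := by
  have hrp : ∀ t, 0 < (c + nd t) ^ (-q) := fun t =>
    Real.rpow_pos_of_pos (add_pos_of_pos_of_nonneg hc (nd_nonneg t)) _
  obtain ⟨y, hy, hy0⟩ : ∃ y ∈ Icc (0 : ℝ) 1, G.eval y ≠ 0 := by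
    by_contra! hcon
    exact hG (eq_zero_of_infinite_isRoot G ((Icc_infinite zero_lt_one).mono hcon))
  obtain ⟨t, ht, rfl⟩ := exists_nd_eq hy
  refine intervalIntegral.integral_pos (by linarith [Real.pi_pos])
    (continuous_lamIntegrand q G hc).continuousOn (fun t _ => ?_) ⟨t, ht, ?_⟩
  · exact mul_nonneg (mul_nonneg (hpos _ ⟨nd_nonneg t, nd_le_one t⟩) (wt_pos t).le) (hrp t).le
  · exact mul_pos (mul_pos ((hpos _ hy).lt_of_ne' hy0) (wt_pos t)) (hrp t)

namespace Sm

theorem zb_of_smul {r : ℝ} (hr : r ≠ 0) {f : Sm} {N : ℕ} (h : ZB (r • f).1 N) : ZB f.1 N :=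
  ZB.of_mul (k := fun _ => r) contDiffOn_const (fun _ _ => hr) (smooth f) (fun _ _ => rfl) h

theorem zb_lam0 {n : ℕ} : ∀ {S W : ℝ[X]} {q : ℝ}, 0 < q → S.natDegree ≤ n → W ≠ 0 →
    (∀ y ∈ Icc (0 : ℝ) 1, 0 ≤ W.eval y) → ZB (lam0 q (W * S.comp (X ^ 2))).1 n := by
  induction n using Nat.strong_induction_on with
  | _ n ih =>
  intro S W q hq hS hW hWpos
  by_cases hS0 : S = 0
  · left
    intro x _
    simp [hS0]
  by_cases hroot : ∃ r ∈ Icc (0 : ℝ) 1, S.IsRoot r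
  · obtain ⟨r, hr, hSr⟩ := hroot
    obtain ⟨S', rfl⟩ := dvd_iff_isRoot.2 hSr
    have hS'0 : S' ≠ 0 := right_ne_zero_of_mul hS0
    have hdeg : S'.natDegree + 1 ≤ n := by
      rw [natDegree_mul (X_sub_C_ne_zero r) hS'0, natDegree_X_sub_C] at hS
      omega
    obtain ⟨k, rfl⟩ : ∃ k, n = k + 1 := ⟨n - 1, by omega⟩
    have hW' : W * ((X - C (√r)) ^ 2 * (X + C (√r))) ≠ 0 := by
      refine mul_ne_zero hW (mul_ne_zero (pow_ne_zero _ (X_sub_C_ne_zero _)) (X_add_C_ne_zero _))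
    have key := ih k (Nat.lt_succ_self k) (q := q + 1) (by positivity)
      (show S'.natDegree ≤ k by omega) hW' (by
        intro y hy
        simp only [eval_mul, eval_pow, eval_sub, eval_add, eval_X, eval_C]
        have := hWpos y hy
        have := hy.1
        positivity)
    have hsq : (C (√r) : ℝ[X]) ^ 2 = C r := by rw [← C_pow, Real.sq_sqrt hr.1]
    have e : R (√r) q (lam0 q (W * ((X - C r) * S').comp (X ^ 2))) =
        q • lam0 (q + 1) (W * ((X - C (√r)) ^ 2 * (X + C (√r))) * S'.comp (X ^ 2)) := by
      rw [← lam_zero 0, R_lam, lam_zero]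
      congr 2
      simp only [mul_comp, sub_comp, X_comp, C_comp]
      linear_combination (-(X - C (√r)) * W * S'.comp (X ^ 2)) * (-hsq)
    refine zb_of_R (a := √r) (q := q) (Or.inl (Real.sqrt_nonneg r)) ?_
    rw [e]
    refine ZB.of_mul (k := fun _ => q⁻¹) contDiffOn_const
      (fun _ _ => inv_ne_zero hq.ne') (smooth _) ?_ key
    intro x _
    change _ = q⁻¹ * (q * _)
    field_simp
  · push Not at hroot
    have hne : W * S.comp (X ^ 2) ≠ 0 := by
      refine mul_ne_zero hW fun h0 => ?_
      have := hroot 0 (by simp)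
      apply this
      have h1 := congrArg (eval 0) h0
      simpa [eval_comp] using h1
    have hsign : (∀ y ∈ Icc (0 : ℝ) 1, 0 ≤ S.eval y) ∨ ∀ y ∈ Icc (0 : ℝ) 1, S.eval y ≤ 0 := by
      by_contra hcon
      push Not at hcon
      obtain ⟨⟨y1, hy1, h1⟩, y2, hy2, h2⟩ := hcon
      obtain ⟨z, hz, hz0⟩ := isPreconnected_Icc.intermediate_value hy1 hy2
        S.continuous.continuousOn ⟨h1.le, h2.le⟩
      exact hroot z hz hz0
    have hsq : ∀ y ∈ Icc (0 : ℝ) 1, y ^ 2 ∈ Icc (0 : ℝ) 1 := fun y hy =>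
      ⟨sq_nonneg y, pow_le_one₀ hy.1 hy.2⟩
    refine ZB.of_ne_zero (fun c hc => ?_) _
    rw [lam0_apply _ _ hc]
    rcases hsign with h | h
    · refine (lamFun_pos hne (fun y hy => ?_) hc.1).ne'
      rw [eval_mul, eval_comp, eval_pow, eval_X]
      exact mul_nonneg (hWpos y hy) (h _ (hsq y hy))
    · have hp : 0 < lamFun q (-(W * S.comp (X ^ 2))) c := by
        refine lamFun_pos (neg_ne_zero.2 hne) (fun y hy => ?_) hc.1
        rw [eval_neg, eval_mul, eval_comp, eval_pow, eval_X]
        exact neg_nonneg.2 (mul_nonpos_of_nonneg_of_nonpos (hWpos y hy) (h _ (hsq y hy)))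
      rw [← lam0_apply _ _ hc, map_neg] at hp
      change 0 < -(lam0 q _).1 c at hp
      rw [lam0_apply _ _ hc] at hp
      linarith

/-- The function `(1 - c)^(-1/2 - i)`. -/
noncomputable def fpow (i : ℕ) : Sm := ofFun fun c => (1 - c) ^ (-(1 / 2 : ℝ) - i)

theorem contDiffOn_rpow (p : ℝ) : ContDiffOn ℝ ∞ (fun c : ℝ => (1 - c) ^ p) (Ioo 0 1) :=
  ContDiffOn.rpow_const_of_ne (by fun_prop) fun c hc => by linarith [hc.2]

theorem fpow_apply (i : ℕ) {c : ℝ} (hc : c ∈ Ioo (0 : ℝ) 1) :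
    (fpow i).1 c = (1 - c) ^ (-(1 / 2 : ℝ) - i) := ofFun_apply (contDiffOn_rpow _) hc

theorem D_fpow (i : ℕ) : D (fpow i) = (1 / 2 + i : ℝ) • fpow (i + 1) := by
  rw [fpow, D_ofFun (contDiffOn_rpow _) (φ' := fun c => (1 / 2 + i : ℝ) *
    (1 - c) ^ (-(1 / 2 : ℝ) - ((i + 1 : ℕ) : ℝ)))]
  · refine ext' fun c hc => ?_
    rw [ofFun_apply (contDiffOn_const.mul (contDiffOn_rpow _)) hc]
    change _ = _ * (fpow (i + 1)).1 c
    rw [fpow_apply _ hc]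
  · intro c hc
    have := ((hasDerivAt_id c).const_sub 1).rpow_const (p := -(1 / 2 : ℝ) - i)
      (Or.inl (by simp only [id]; linarith [hc.2]))
    refine this.congr_deriv ?_
    simp only [id]
    push_cast
    rw [show -(1 / 2 : ℝ) - i - 1 = -(1 / 2 : ℝ) - (i + 1) by ring]
    ring

theorem mulX_fpow (i : ℕ) : mulX (fpow (i + 1)) = fpow (i + 1) - fpow i := by
  refine ext' fun c hc => ?_
  change c * (fpow (i + 1)).1 c = (fpow (i + 1)).1 c - (fpow i).1 c
  rw [fpow_apply _ hc, fpow_apply _ hc]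
  rw [show -(1 / 2 : ℝ) - i = -(1 / 2 : ℝ) - (i + 1 : ℕ) + 1 by push_cast; ring,
    Real.rpow_add_one (by linarith [hc.2])]
  ring

theorem theta_fpow (i : ℕ) : theta (fpow i) = (1 / 2 + i : ℝ) • (fpow (i + 1) - fpow i) := by
  rw [theta_apply, D_fpow, map_smul, mulX_fpow]

theorem R_fpow (i k : ℕ) : R (-1) (1 / 2 + k) (fpow i) = ((k : ℝ) - i) • fpow i := by
  rw [R_apply, D_fpow, map_smul, mulX_fpow]
  module

theorem theta_pow_fpow_mem (i : ℕ) :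
    (theta ^ i) (fpow 0) ∈ Submodule.span ℝ (fpow '' Iic i) := by
  induction i with
  | zero => exact Submodule.subset_span ⟨0, by simp, by simp⟩
  | succ i ih =>
    rw [pow_succ', Module.End.mul_apply]
    have hle : Submodule.span ℝ (fpow '' Iic i) ≤
        (Submodule.span ℝ (fpow '' Iic (i + 1))).comap theta := by
      rw [Submodule.span_le]
      rintro _ ⟨j, hj, rfl⟩
      have hj' : j ≤ i := hj
      rw [SetLike.mem_coe, Submodule.mem_comap, theta_fpow]
      exact Submodule.smul_mem _ _ (Submodule.sub_mem _
        (Submodule.subset_span ⟨j + 1, by simpa using hj', rfl⟩)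
        (Submodule.subset_span ⟨j, by simp; omega, rfl⟩))
    exact hle ih

/-- The composition of the operators `R (b k) (1/2 + k)`. -/
noncomputable def opR (b : ℕ → ℝ) : ℕ → Module.End ℝ Sm
  | 0 => 1
  | k + 1 => R (b k) (1 / 2 + k) * opR b k

theorem opR_succ (b : ℕ → ℝ) (k : ℕ) (f : Sm) :
    opR b (k + 1) f = R (b k) (1 / 2 + k) (opR b k f) := rfl

theorem zb_of_opR {b : ℕ → ℝ} (hb : ∀ k, 0 ≤ b k ∨ b k ≤ -1) (k : ℕ) {f : Sm} {N : ℕ}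
    (h : ZB (opR b k f).1 N) : ZB f.1 (N + k) := by
  induction k generalizing N with
  | zero => exact h
  | succ k ih =>
    rw [opR_succ] at h
    have := ih (zb_of_R (hb k) h)
    rwa [show N + (k + 1) = N + 1 + k by omega]

theorem opR_lam (a b : ℕ → ℝ) (i k : ℕ) : opR b k (lam a i (1 / 2) 1) =
    (∏ l ∈ Finset.range k, (1 / 2 + l : ℝ)) •
      lam a i (1 / 2 + k) (∏ l ∈ Finset.range k, (X - C (b l))) := by
  induction k with
  | zero => simp [opR]
  | succ k ih =>
    rw [opR_succ, ih, map_smul, R_lam, Finset.prod_range_succ, Finset.prod_range_succ, smul_smul,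
      mul_comm (X - C (b k))]
    push_cast
    rw [add_assoc]

theorem opR_fpow {b : ℕ → ℝ} {m i : ℕ} (hb : ∀ k ≤ m, b k = -1) (hi : i ≤ m) {k : ℕ} (hk : m < k) :
    opR b k (fpow i) = 0 := by
  have h1 : ∀ k ≤ i, ∃ r : ℝ, opR b k (fpow i) = r • fpow i := by
    intro k
    induction k with
    | zero => exact fun _ => ⟨1, by simp [opR]⟩
    | succ k ih =>
      intro hk
      obtain ⟨r, hr⟩ := ih (by omega)
      refine ⟨r * ((k : ℝ) - i), ?_⟩
      rw [opR_succ, hr, map_smul, hb k (by omega), R_fpow, smul_smul]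
  have h2 : ∀ d, opR b (i + 1 + d) (fpow i) = 0 := by
    intro d
    induction d with
    | zero =>
      obtain ⟨r, hr⟩ := h1 i le_rfl
      rw [add_zero, opR_succ, hr, map_smul, hb i hi, R_fpow]
      simp
    | succ d ih => rw [← add_assoc, opR_succ, ih, map_zero]
  obtain ⟨d, rfl⟩ := Nat.exists_eq_add_of_lt (hi.trans_lt hk)
  have := h2 d
  rwa [show i + d + 1 = i + 1 + d by omega]

theorem lam_iterate {a : ℕ → ℝ} (m k : ℕ) :
    aeval theta (∏ i ∈ Finset.range k, (X - C (a (m + i)))) (lam a m (1 / 2) 1) =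
      lam a (m + k) (1 / 2) 1 := by
  induction k with
  | zero => simp
  | succ k ih =>
    rw [Finset.prod_range_succ, mul_comm, map_mul, Module.End.mul_apply, ih, ← add_assoc,
      ← theta_lam]
    simp [Algebra.algebraMap_eq_smul_one]

theorem zb_main {n N : ℕ} {p q : ℝ[X]} (hp : p.natDegree ≤ n + N + 1) (hq : q.natDegree ≤ n) :
    ZB (aeval theta p (fpow 0) +
      aeval theta (q * ∏ k ∈ Finset.range (N + 1), (X - C (2 * k : ℝ))) (lam0 (1 / 2) 1)).1
      (3 * n + 2 * N + 3) := by
  classical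
  set a : ℕ → ℝ := fun i => if i ≤ N then 2 * i else 0 with ha
  have ha1 : ∀ i ≤ N, a i = 2 * i := fun i hi => by simp [ha, hi]
  have ha2 : ∀ i, N < i → a i = 0 := fun i hi => by simp [ha, not_le.2 hi]
  set M := n + N + 1 with hM
  set b : ℕ → ℝ := fun k => if k ≤ M then -1 else 1 with hb
  have hb1 : ∀ k ≤ M, b k = -1 := fun k hk => by simp [hb, hk]
  have hb2 : ∀ k, 0 ≤ b k ∨ b k ≤ -1 := fun k => by
    by_cases hk : k ≤ M <;> simp [hb, hk]
  have e1 : aeval theta (∏ k ∈ Finset.range (N + 1), (X - C (2 * k : ℝ))) (lam0 (1 / 2) 1) =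
      lam a (N + 1) (1 / 2) 1 := by
    have := lam_iterate (a := a) 0 (N + 1)
    rw [zero_add, lam_zero] at this
    rw [← this]
    have hi : ∀ i ∈ Finset.range (N + 1), (X - C (2 * i : ℝ)) = X - C (a (0 + i)) := fun i hi => by
      rw [zero_add, ha1 i (by have := Finset.mem_range.1 hi; omega)]
    rw [Finset.prod_congr rfl hi]
  have e2 : ∀ i, (theta ^ i) (lam a (N + 1) (1 / 2) 1) = lam a (N + 1 + i) (1 / 2) 1 := by
    intro i
    have := lam_iterate (a := a) (N + 1) i
    rw [← this]
    have : ∏ j ∈ Finset.range i, (X - C (a (N + 1 + j))) = X ^ i := by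
      have hj : ∀ j ∈ Finset.range i, X - C (a (N + 1 + j)) = X := fun j _ => by
        rw [ha2 (N + 1 + j) (by omega), C_0, sub_zero]
      rw [Finset.prod_congr rfl hj]
      simp
    rw [this]
    simp
  have e3 : opR b (2 * M + 1) (aeval theta p (fpow 0)) = 0 := by
    rw [aeval_eq_sum_range' (n := M + 1) (by omega), LinearMap.sum_apply, map_sum]
    refine Finset.sum_eq_zero fun i hi => ?_
    rw [LinearMap.smul_apply, map_smul]
    have hle : Submodule.span ℝ (fpow '' Iic i) ≤ LinearMap.ker (opR b (2 * M + 1)) := by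
      rw [Submodule.span_le]
      rintro _ ⟨j, hj, rfl⟩
      have hj' : j ≤ i := hj
      have := Finset.mem_range.1 hi
      exact opR_fpow hb1 (show j ≤ M by omega) (by omega)
    rw [LinearMap.mem_ker.1 (hle (theta_pow_fpow_mem i)), smul_zero]
  have e4 : ∏ l ∈ Finset.range (2 * M + 1), (X - C (b l)) =
      (-1 : ℝ[X]) ^ M * ((1 - X ^ 2) ^ M * (1 + X)) := by
    rw [show 2 * M + 1 = M + 1 + M by ring, Finset.prod_range_add]
    rw [Finset.prod_congr rfl (g := fun _ => (X + 1 : ℝ[X])) fun j hj => by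
        rw [hb1 j (by have := Finset.mem_range.1 hj; omega)]; simp,
      Finset.prod_congr (s₁ := Finset.range M) rfl (g := fun _ => (X - 1 : ℝ[X])) fun j hj => by
        rw [show b (M + 1 + j) = 1 from if_neg (by omega), C_1]]
    simp only [Finset.prod_const, Finset.card_range]
    rw [pow_succ, show (1 - X ^ 2 : ℝ[X]) = (-1) * ((X + 1) * (X - 1)) by ring, mul_pow, mul_pow]
    have : (-1 : ℝ[X]) ^ M * (-1) ^ M = 1 := by rw [← mul_pow]; simp
    linear_combination (-(X + 1) ^ M * (X - 1) ^ M * (1 + X)) * this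
  set S0 : ℝ[X] := ∑ i ∈ Finset.range (n + 1),
    C (q.coeff i) * ((1 - X) ^ (n - i) * redPoly a (N + 1 + i)) with hS0
  have hdvd : X ^ (N + 1) ∣ S0 := by
    refine Finset.dvd_sum fun i _ => Dvd.dvd.mul_left (Dvd.dvd.mul_left ?_ _) _
    have := X_pow_dvd_redPoly ha1 ha2 (N + 1 + i)
    rwa [min_eq_right (by omega)] at this
  have hdeg : S0.natDegree ≤ n + (N + 1) := by
    refine natDegree_sum_le_of_forall_le _ _ fun i hi => ?_
    have hi' := Finset.mem_range.1 hi
    refine (natDegree_C_mul_le _ _).trans ?_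
    have h1 : ((1 - X : ℝ[X]) ^ (n - i)).natDegree ≤ n - i := by
      have : (1 - X : ℝ[X]).natDegree ≤ 1 := by compute_degree
      exact (natDegree_pow_le_of_le (n - i) this).trans (by simp)
    have := natDegree_mul_le_of_le h1 (natDegree_redPoly a (N + 1 + i))
    omega
  obtain ⟨S, hS⟩ := hdvd
  have hSdeg : S.natDegree ≤ n := by
    by_cases h0 : S = 0
    · simp [h0]
    · rw [hS, natDegree_mul (pow_ne_zero _ X_ne_zero) h0, natDegree_X_pow] at hdeg
      omega
  have e5 : ∀ i ∈ Finset.range (n + 1), ∀ Q : ℝ,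
      lam a (N + 1 + i) Q ((-1 : ℝ[X]) ^ M * ((1 - X ^ 2) ^ M * (1 + X))) =
      (-1 : ℝ) ^ M • lam0 Q
        (((1 - X) ^ (n - i) * redPoly a (N + 1 + i)).comp (X ^ 2) * (1 + X)) := by
    intro i hi Q
    have hi' := Finset.mem_range.1 hi
    have h1 : (-1 : ℝ[X]) ^ M = C ((-1 : ℝ) ^ M) := by simp
    rw [h1, C_mul', map_smul]
    congr 1
    have := lam_reduce a (N + 1 + i) (n - i) Q (1 + X)
    rw [show n - i + (N + 1 + i) = M by omega] at this
    rw [this]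
    simp
  set Q : ℝ := 1 / 2 + ((2 * M + 1 : ℕ) : ℝ) with hQ
  have e6 : opR b (2 * M + 1) (aeval theta p (fpow 0) +
      aeval theta (q * ∏ k ∈ Finset.range (N + 1), (X - C (2 * k : ℝ))) (lam0 (1 / 2) 1)) =
      ((∏ l ∈ Finset.range (2 * M + 1), (1 / 2 + l : ℝ)) * (-1 : ℝ) ^ M) •
        lam0 Q (((1 + X) * X ^ (2 * (N + 1))) * S.comp (X ^ 2)) := by
    have h1 : ((1 + X) * X ^ (2 * (N + 1))) * S.comp (X ^ 2) = S0.comp (X ^ 2) * (1 + X) := by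
      rw [hS]
      simp only [mul_comp, pow_comp, X_comp, pow_mul]
      ring
    rw [map_add, e3, zero_add, map_mul, Module.End.mul_apply, e1,
      aeval_eq_sum_range' (n := n + 1) (by omega), LinearMap.sum_apply, map_sum, h1, hS0,
      Polynomial.sum_comp, Finset.sum_mul, map_sum, Finset.smul_sum]
    refine Finset.sum_congr rfl fun i hi => ?_
    rw [LinearMap.smul_apply, map_smul, e2, opR_lam, e4, e5 i hi, mul_comp (C _), C_comp,
      mul_assoc (C _), C_mul', map_smul]
    module
  have key : ZB (lam0 Q (((1 + X) * X ^ (2 * (N + 1))) * S.comp (X ^ 2))).1 n := by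
    refine zb_lam0 (by positivity) hSdeg ?_ ?_
    · refine mul_ne_zero (fun h => ?_) (pow_ne_zero _ X_ne_zero)
      have := congrArg (eval 0) h
      simp at this
    · intro y hy
      have := hy.1
      simp only [eval_mul, eval_pow, eval_add, eval_X, eval_one]
      positivity
  have hconst : ((∏ l ∈ Finset.range (2 * M + 1), (1 / 2 + l : ℝ)) * (-1 : ℝ) ^ M) ≠ 0 :=
    mul_ne_zero (Finset.prod_ne_zero_iff.2 fun l _ => by positivity) (pow_ne_zero _ (by norm_num))
  have key2 : ZB (opR b (2 * M + 1) (aeval theta p (fpow 0) +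
      aeval theta (q * ∏ k ∈ Finset.range (N + 1), (X - C (2 * k : ℝ))) (lam0 (1 / 2) 1))).1 n := by
    rw [e6]
    refine zb_of_smul (inv_ne_zero hconst) ?_
    rwa [smul_smul, inv_mul_cancel₀ hconst, one_smul]
  have := zb_of_opR hb2 _ key2
  rwa [show n + (2 * M + 1) = 3 * n + 2 * N + 3 by omega] at this

end Sm

/-- The half width `√(1 - c)` of the oval, as a function of `c = 8 √h`. -/
noncomputable def uu (c : ℝ) : ℝ := √(1 - c)

/-- The quantity `4 x (1 - x)` along the parametrised oval. -/
noncomputable def zz (c t : ℝ) : ℝ := 1 - (1 - c) * Real.sin t ^ 2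

/-- The square root of `c + 4 x (1 - x)` along the parametrised oval. -/
noncomputable def sg (c t : ℝ) : ℝ := √(c + zz c t)

section basics

variable {c : ℝ}

theorem uu_sq (hc : c ∈ Ioo (0 : ℝ) 1) : uu c ^ 2 = 1 - c := Real.sq_sqrt (by linarith [hc.2])

theorem uu_pos (hc : c ∈ Ioo (0 : ℝ) 1) : 0 < uu c := Real.sqrt_pos.2 (by linarith [hc.2])

theorem zz_pos (hc : c ∈ Ioo (0 : ℝ) 1) (t : ℝ) : 0 < zz c t := by
  have h1 := Real.sin_sq_le_one t
  have h2 := hc.1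
  have h3 := hc.2
  have : zz c t = (1 - Real.sin t ^ 2) + c * Real.sin t ^ 2 := by rw [zz]; ring
  rw [this]
  nlinarith [sq_nonneg (Real.sin t)]

theorem sg_arg_pos (hc : c ∈ Ioo (0 : ℝ) 1) (t : ℝ) : 0 < c + zz c t :=
  add_pos hc.1 (zz_pos hc t)

theorem sg_sq (hc : c ∈ Ioo (0 : ℝ) 1) (t : ℝ) : sg c t ^ 2 = c + zz c t :=
  Real.sq_sqrt (sg_arg_pos hc t).le

theorem sg_pos (hc : c ∈ Ioo (0 : ℝ) 1) (t : ℝ) : 0 < sg c t := Real.sqrt_pos.2 (sg_arg_pos hc t)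

theorem hasDerivAt_uu (hc : c ∈ Ioo (0 : ℝ) 1) : HasDerivAt uu (-1 / (2 * uu c)) c :=
  ((hasDerivAt_id c).const_sub 1).sqrt (by simp only [id]; linarith [hc.2])

theorem hasDerivAt_zz_left (c t : ℝ) : HasDerivAt (fun c => zz c t) (Real.sin t ^ 2) c := by
  have := (((hasDerivAt_id c).const_sub 1).mul_const (Real.sin t ^ 2)).const_sub 1
  exact this.congr_deriv (by ring)

theorem hasDerivAt_zz_right (c t : ℝ) :
    HasDerivAt (zz c) (-(2 * (1 - c) * Real.sin t * Real.cos t)) t := by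
  have := (((Real.hasDerivAt_sin t).pow 2).const_mul (1 - c)).const_sub 1
  exact this.congr_deriv (by push_cast; ring)

theorem hasDerivAt_sg_left (hc : c ∈ Ioo (0 : ℝ) 1) (t : ℝ) :
    HasDerivAt (fun c => sg c t) ((1 + Real.sin t ^ 2) / (2 * sg c t)) c :=
  ((hasDerivAt_id c).add (hasDerivAt_zz_left c t)).sqrt (sg_arg_pos hc t).ne'

theorem hasDerivAt_sg_right (hc : c ∈ Ioo (0 : ℝ) 1) (t : ℝ) :
    HasDerivAt (sg c) (-((1 - c) * Real.sin t * Real.cos t) / sg c t) t := by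
  have := ((hasDerivAt_zz_right c t).const_add c).sqrt (sg_arg_pos hc t).ne'
  refine this.congr_deriv ?_
  have := (sg_pos hc t).ne'
  change _ / (2 * sg c t) = _
  field_simp

end basics

theorem ContDiffOn.zpow_of_pos {E : Type*} [NormedAddCommGroup E] [NormedSpace ℝ E] {s : Set E}
    {f : E → ℝ} (hf : ContDiffOn ℝ ∞ f s) (hpos : ∀ x ∈ s, 0 < f x) (m : ℤ) :
    ContDiffOn ℝ ∞ (fun x => f x ^ m) s := by
  cases m with
  | ofNat k => simpa using hf.pow k
  | negSucc k =>
    simp only [zpow_negSucc]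
    exact (hf.pow (k + 1)).inv fun x hx => (pow_pos (hpos x hx) _).ne'

theorem contDiffOn_uu : ContDiffOn ℝ ∞ (fun p : ℝ × ℝ => uu p.1) (Ioo (0 : ℝ) 1 ×ˢ univ) :=
  ContDiffOn.sqrt (by fun_prop) fun p hp => by linarith [hp.1.2]

theorem contDiff_zz : ContDiff ℝ ∞ (fun p : ℝ × ℝ => zz p.1 p.2) := by
  unfold zz
  have : ContDiff ℝ ∞ fun p : ℝ × ℝ => Real.sin p.2 := Real.contDiff_sin.comp contDiff_snd
  exact contDiff_const.sub ((contDiff_const.sub contDiff_fst).mul (this.pow 2))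

theorem contDiffOn_sg :
    ContDiffOn ℝ ∞ (fun p : ℝ × ℝ => sg p.1 p.2) (Ioo (0 : ℝ) 1 ×ˢ univ) :=
  ContDiffOn.sqrt (contDiff_fst.add contDiff_zz).contDiffOn fun p hp => (sg_arg_pos hp.1 p.2).ne'

/-- The integrand of the basic integrals. -/
noncomputable def tt (J E : ℕ) (c t : ℝ) : ℝ :=
  (uu c * Real.cos t) ^ J * sg c t ^ ((J : ℤ) - 1) * zz c t ^ ((E : ℤ) - J)

theorem contDiffOn_tt (J E : ℕ) :
    ContDiffOn ℝ ∞ (fun p : ℝ × ℝ => tt J E p.1 p.2) (Ioo (0 : ℝ) 1 ×ˢ univ) := by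
  have hcos : ContDiff ℝ ∞ fun p : ℝ × ℝ => Real.cos p.2 := Real.contDiff_cos.comp contDiff_snd
  exact (((contDiffOn_uu.mul hcos.contDiffOn).pow J).mul
    (contDiffOn_sg.zpow_of_pos (fun p hp => sg_pos hp.1 p.2) _)).mul
    (contDiff_zz.contDiffOn.zpow_of_pos (fun p hp => zz_pos hp.1 p.2) _)

theorem continuous_of_contDiffOn_prod {F : ℝ × ℝ → ℝ}
    (hF : ContDiffOn ℝ ∞ F (Ioo (0 : ℝ) 1 ×ˢ univ)) {c : ℝ} (hc : c ∈ Ioo (0 : ℝ) 1) :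
    Continuous fun t => F (c, t) := by
  rw [← continuousOn_univ]
  exact hF.continuousOn.comp (by fun_prop) fun t _ => ⟨hc, mem_univ _⟩

theorem continuous_tt (J E : ℕ) {c : ℝ} (hc : c ∈ Ioo (0 : ℝ) 1) : Continuous (tt J E c) :=
  continuous_of_contDiffOn_prod (contDiffOn_tt J E) hc

theorem continuous_deriv_tt (J E : ℕ) {c : ℝ} (hc : c ∈ Ioo (0 : ℝ) 1) :
    Continuous fun t => deriv (fun c => tt J E c t) c :=
  continuous_of_contDiffOn_prod (contDiffOn_partialDeriv (contDiffOn_tt J E)).1 hc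

/-- The basic integrals. -/
noncomputable def TTFun (J E : ℕ) (c : ℝ) : ℝ :=
  ∫ t in (-(Real.pi / 2))..(Real.pi / 2), tt J E c t

theorem contDiffOn_TTFun (J E : ℕ) : ContDiffOn ℝ ∞ (TTFun J E) (Ioo 0 1) :=
  contDiffOn_integral_param (contDiffOn_tt J E) _ _

theorem hasDerivAt_zpow_comp {f : ℝ → ℝ} {f' x : ℝ} (hf : HasDerivAt f f' x) (h0 : f x ≠ 0)
    (m : ℤ) : HasDerivAt (fun x => f x ^ m) (m * f x ^ (m - 1) * f') x :=
  (hasDerivAt_zpow m (f x) (Or.inl h0)).comp x hf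

theorem hasDerivAt_tt (k E : ℕ) {c : ℝ} (hc : c ∈ Ioo (0 : ℝ) 1) (t : ℝ) :
    HasDerivAt (fun c => tt (k + 2) E c t)
      ((uu c * Real.cos t) ^ k * sg c t ^ ((k : ℤ) - 1) * zz c t ^ ((E : ℤ) - k - 3) *
        (-((k + 2) / 2) * Real.cos t ^ 2 * (c + zz c t) * zz c t +
          (1 - c) * Real.cos t ^ 2 * ((k + 1) / 2 * (1 + Real.sin t ^ 2)) * zz c t +
          (1 - c) * Real.cos t ^ 2 * (c + zz c t) * (((E : ℝ) - k - 2) * Real.sin t ^ 2))) c := by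
  have hu := (uu_pos hc).ne'
  have hz := (zz_pos hc t).ne'
  have hs := (sg_pos hc t).ne'
  have h := ((((hasDerivAt_uu hc).mul_const (Real.cos t)).pow (k + 2)).mul
    (hasDerivAt_zpow_comp (hasDerivAt_sg_left hc t) hs (((k + 2 : ℕ) : ℤ) - 1))).mul
    (hasDerivAt_zpow_comp (hasDerivAt_zz_left c t) hz ((E : ℤ) - ((k + 2 : ℕ) : ℤ)))
  refine h.congr_deriv ?_
  have e1 : sg c t ^ (((k + 2 : ℕ) : ℤ) - 1) = sg c t ^ ((k : ℤ) - 1) * sg c t ^ 2 := by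
    rw [← zpow_natCast, ← zpow_add₀ hs]; congr 1; push_cast; ring
  have e2 : sg c t ^ (((k + 2 : ℕ) : ℤ) - 1 - 1) = sg c t ^ ((k : ℤ) - 1) * sg c t := by
    rw [← zpow_add_one₀ hs]; congr 1; push_cast; ring
  have e3 : zz c t ^ ((E : ℤ) - ((k + 2 : ℕ) : ℤ)) = zz c t ^ ((E : ℤ) - k - 3) * zz c t := by
    rw [← zpow_add_one₀ hz]; congr 1; push_cast; ring
  have e4 : zz c t ^ ((E : ℤ) - ((k + 2 : ℕ) : ℤ) - 1) = zz c t ^ ((E : ℤ) - k - 3) := by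
    congr 1; push_cast; ring
  simp only [Pi.mul_apply, Pi.pow_apply]
  rw [e1, e2, e3, e4, ← sg_sq hc t, ← uu_sq hc]
  generalize sg c t ^ ((k : ℤ) - 1) = A
  generalize zz c t ^ ((E : ℤ) - k - 3) = B
  simp only [show k + 2 - 1 = k + 1 by omega]
  push_cast
  rw [pow_succ (uu c * Real.cos t) k, pow_add (uu c * Real.cos t) k 2]
  field_simp
  ring

/-- The `t`-derivative of the primitives used for integration by parts. -/
theorem hasDerivAt_primitive (k E : ℕ) {c : ℝ} (hc : c ∈ Ioo (0 : ℝ) 1) (t : ℝ) :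
    HasDerivAt (fun t => uu c * Real.sin t * (uu c * Real.cos t) ^ (k + 1) *
        sg c t ^ ((k : ℤ) + 1) * zz c t ^ ((E : ℤ) - k - 2))
      ((uu c * Real.cos t) ^ k * sg c t ^ ((k : ℤ) - 1) * zz c t ^ ((E : ℤ) - k - 3) *
        ((1 - c) * Real.cos t ^ 2 * (c + zz c t) * zz c t -
          (k + 1) * (1 - c) * Real.sin t ^ 2 * (c + zz c t) * zz c t -
          (k + 1) * (1 - c) ^ 2 * Real.sin t ^ 2 * Real.cos t ^ 2 * zz c t -
          2 * ((E : ℝ) - k - 2) * (1 - c) ^ 2 * Real.sin t ^ 2 * Real.cos t ^ 2 *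
            (c + zz c t))) t := by
  have hu := (uu_pos hc).ne'
  have hz := (zz_pos hc t).ne'
  have hs := (sg_pos hc t).ne'
  have h := ((((Real.hasDerivAt_sin t).const_mul (uu c)).mul
    (((Real.hasDerivAt_cos t).const_mul (uu c)).pow (k + 1))).mul
    (hasDerivAt_zpow_comp (hasDerivAt_sg_right hc t) hs ((k : ℤ) + 1))).mul
    (hasDerivAt_zpow_comp (hasDerivAt_zz_right c t) hz ((E : ℤ) - k - 2))
  refine h.congr_deriv ?_
  have e1 : sg c t ^ ((k : ℤ) + 1) = sg c t ^ ((k : ℤ) - 1) * sg c t ^ 2 := by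
    rw [← zpow_natCast, ← zpow_add₀ hs]; congr 1; push_cast; ring
  have e2 : sg c t ^ ((k : ℤ) + 1 - 1) = sg c t ^ ((k : ℤ) - 1) * sg c t := by
    rw [← zpow_add_one₀ hs]; congr 1; ring
  have e3 : zz c t ^ ((E : ℤ) - k - 2) = zz c t ^ ((E : ℤ) - k - 3) * zz c t := by
    rw [← zpow_add_one₀ hz]; congr 1; ring
  have e4 : zz c t ^ ((E : ℤ) - k - 2 - 1) = zz c t ^ ((E : ℤ) - k - 3) := by
    congr 1; ring
  simp only [Pi.mul_apply, Pi.pow_apply]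
  rw [e1, e2, e3, e4, ← sg_sq hc t, ← uu_sq hc]
  generalize sg c t ^ ((k : ℤ) - 1) = A
  generalize zz c t ^ ((E : ℤ) - k - 3) = B
  simp only [Nat.add_sub_cancel]
  push_cast
  rw [pow_succ (uu c * Real.cos t) k]
  field_simp
  ring

theorem tt_add_two (k E : ℕ) {c : ℝ} (hc : c ∈ Ioo (0 : ℝ) 1) (t : ℝ) :
    tt (k + 2) E c t =
      (uu c * Real.cos t) ^ k * sg c t ^ ((k : ℤ) - 1) * zz c t ^ ((E : ℤ) - k - 3) *
        ((1 - c) * Real.cos t ^ 2 * (c + zz c t) * zz c t) := by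
  have hz := (zz_pos hc t).ne'
  have hs := (sg_pos hc t).ne'
  have e1 : sg c t ^ (((k + 2 : ℕ) : ℤ) - 1) = sg c t ^ ((k : ℤ) - 1) * sg c t ^ 2 := by
    rw [← zpow_natCast, ← zpow_add₀ hs]; congr 1; push_cast; ring
  have e3 : zz c t ^ ((E : ℤ) - ((k + 2 : ℕ) : ℤ)) = zz c t ^ ((E : ℤ) - k - 3) * zz c t := by
    rw [← zpow_add_one₀ hz]; congr 1; push_cast; ring
  rw [tt, e1, e3, ← sg_sq hc t, ← uu_sq hc]
  ring

theorem tt_eq (k E : ℕ) {c : ℝ} (hc : c ∈ Ioo (0 : ℝ) 1) (t : ℝ) :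
    tt k E c t =
      (uu c * Real.cos t) ^ k * sg c t ^ ((k : ℤ) - 1) * zz c t ^ ((E : ℤ) - k - 3) *
        zz c t ^ 3 := by
  have hz := (zz_pos hc t).ne'
  have e3 : zz c t ^ ((E : ℤ) - k) = zz c t ^ ((E : ℤ) - k - 3) * zz c t ^ 3 := by
    rw [← zpow_natCast (zz c t) 3, ← zpow_add₀ hz]; congr 1; push_cast; ring
  rw [tt, e3]
  ring

theorem tt_eq_pred (k E : ℕ) {c : ℝ} (hc : c ∈ Ioo (0 : ℝ) 1) (t : ℝ) :
    tt k E c t =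
      (uu c * Real.cos t) ^ k * sg c t ^ ((k : ℤ) - 1) * zz c t ^ (((E + 1 : ℕ) : ℤ) - k - 3) *
        zz c t ^ 2 := by
  have hz := (zz_pos hc t).ne'
  have e3 : zz c t ^ ((E : ℤ) - k) = zz c t ^ (((E + 1 : ℕ) : ℤ) - k - 3) * zz c t ^ 2 := by
    rw [← zpow_natCast (zz c t) 2, ← zpow_add₀ hz]; congr 1; push_cast; ring
  rw [tt, e3]
  ring

theorem tt_add_two_pred (k E : ℕ) {c : ℝ} (hc : c ∈ Ioo (0 : ℝ) 1) (t : ℝ) :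
    tt (k + 2) E c t =
      (uu c * Real.cos t) ^ k * sg c t ^ ((k : ℤ) - 1) * zz c t ^ (((E + 1 : ℕ) : ℤ) - k - 3) *
        ((1 - c) * Real.cos t ^ 2 * (c + zz c t)) := by
  have hz := (zz_pos hc t).ne'
  rw [tt_add_two k E hc]
  have e3 : zz c t ^ (((E + 1 : ℕ) : ℤ) - k - 3) = zz c t ^ ((E : ℤ) - k - 3) * zz c t := by
    rw [← zpow_add_one₀ hz]; congr 1; push_cast; ring
  rw [e3]
  ring

namespace Sm

/-- The basic integrals as elements of `Sm`. -/
noncomputable def TT (J E : ℕ) : Sm := ofFun (TTFun J E)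

theorem TT_apply (J E : ℕ) {c : ℝ} (hc : c ∈ Ioo (0 : ℝ) 1) : (TT J E).1 c = TTFun J E c :=
  ofFun_apply (contDiffOn_TTFun J E) hc

theorem theta_TT_apply (J E : ℕ) {c : ℝ} (hc : c ∈ Ioo (0 : ℝ) 1) :
    (theta (TT J E)).1 c =
      c * ∫ t in (-(Real.pi / 2))..(Real.pi / 2), deriv (fun c => tt J E c t) c := by
  rw [theta_apply, mulX_apply, D_apply _ hc]
  congr 1
  have h := hasDerivAt_integral_param (contDiffOn_tt J E) (-(Real.pi / 2)) (Real.pi / 2) hc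
  rw [← h.deriv]
  refine Filter.EventuallyEq.deriv_eq ?_
  filter_upwards [Ioo_mem_nhds hc.1 hc.2] with y hy
  exact TT_apply J E hy

end Sm

theorem integral_primitive_eq_zero {f f' : ℝ → ℝ} (hf : ∀ t, HasDerivAt f (f' t) t)
    (hc : Continuous f') (h1 : f (-(Real.pi / 2)) = 0) (h2 : f (Real.pi / 2) = 0) :
    ∫ t in (-(Real.pi / 2))..(Real.pi / 2), f' t = 0 := by
  rw [intervalIntegral.integral_eq_sub_of_hasDerivAt (fun t _ => hf t)
    (hc.intervalIntegrable _ _), h1, h2, sub_zero]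

/-- Integrals of `t`-derivatives of the primitives vanish. -/
theorem integral_eq_zero_of_primitive (k E : ℕ) {c : ℝ} (hc : c ∈ Ioo (0 : ℝ) 1) (r : ℝ)
    {g : ℝ → ℝ} (hg : Continuous g)
    (h : ∀ t, g t = r * ((uu c * Real.cos t) ^ k * sg c t ^ ((k : ℤ) - 1) *
        zz c t ^ ((E : ℤ) - k - 3) *
        ((1 - c) * Real.cos t ^ 2 * (c + zz c t) * zz c t -
          (k + 1) * (1 - c) * Real.sin t ^ 2 * (c + zz c t) * zz c t -
          (k + 1) * (1 - c) ^ 2 * Real.sin t ^ 2 * Real.cos t ^ 2 * zz c t -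
          2 * ((E : ℝ) - k - 2) * (1 - c) ^ 2 * Real.sin t ^ 2 * Real.cos t ^ 2 *
            (c + zz c t)))) :
    ∫ t in (-(Real.pi / 2))..(Real.pi / 2), g t = 0 := by
  refine integral_primitive_eq_zero
    (fun t => ((hasDerivAt_primitive k E hc t).const_mul r).congr_deriv (h t).symm) hg ?_ ?_ <;>
  simp

namespace Sm

theorem theta_TT (k E : ℕ) :
    theta (TT (k + 2) E) = (k + 1 : ℝ) • TT (k + 2) E - (k + 1 : ℝ) • TT k E := by
  refine ext' fun c hc => ?_
  have h1 : 1 - c ≠ 0 := by linarith [hc.2]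
  have key : ∫ t in (-(Real.pi / 2))..(Real.pi / 2),
      (c * deriv (fun c => tt (k + 2) E c t) c - (k + 1) * tt (k + 2) E c t +
        (k + 1) * tt k E c t) = 0 := by
    refine integral_eq_zero_of_primitive k E hc (-(1 / 2) * (c / (1 - c)))
      (((continuous_const.mul (continuous_deriv_tt _ _ hc)).sub
        (continuous_const.mul (continuous_tt _ _ hc))).add
        (continuous_const.mul (continuous_tt _ _ hc))) fun t => ?_
    rw [(hasDerivAt_tt k E hc t).deriv, tt_add_two k E hc, tt_eq k E hc, Real.cos_sq']
    generalize (uu c * Real.cos t) ^ k * sg c t ^ ((k : ℤ) - 1) * zz c t ^ ((E : ℤ) - k - 3) = P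
    rw [zz]
    field_simp
    ring
  have i1 := (continuous_deriv_tt (k + 2) E hc).intervalIntegrable
    (μ := MeasureTheory.volume) (-(Real.pi / 2)) (Real.pi / 2)
  have i2 := (continuous_tt (k + 2) E hc).intervalIntegrable
    (μ := MeasureTheory.volume) (-(Real.pi / 2)) (Real.pi / 2)
  have i3 := (continuous_tt k E hc).intervalIntegrable
    (μ := MeasureTheory.volume) (-(Real.pi / 2)) (Real.pi / 2)
  rw [intervalIntegral.integral_add ((i1.const_mul _).sub (i2.const_mul _)) (i3.const_mul _),
    intervalIntegral.integral_sub (i1.const_mul _) (i2.const_mul _),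
    intervalIntegral.integral_const_mul, intervalIntegral.integral_const_mul,
    intervalIntegral.integral_const_mul] at key
  rw [theta_TT_apply _ _ hc]
  change _ = (k + 1) * (TT (k + 2) E).1 c - (k + 1) * (TT k E).1 c
  rw [TT_apply _ _ hc, TT_apply _ _ hc, TTFun, TTFun]
  linarith

theorem theta_TT_succ_of_add_two (k e : ℕ) :
    theta (TT (k + 2) (e + 1)) - (e + 1 / 2 : ℝ) • TT (k + 2) (e + 1) =
      theta (TT (k + 2) e) - (e : ℝ) • TT (k + 2) e := by
  rw [theta_TT, theta_TT]
  refine ext' fun c hc => ?_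
  have key : ∫ t in (-(Real.pi / 2))..(Real.pi / 2),
      ((k + 1 - e - 1 / 2) * tt (k + 2) (e + 1) c t - (k + 1) * tt k (e + 1) c t -
        (k + 1 - e) * tt (k + 2) e c t + (k + 1) * tt k e c t) = 0 := by
    refine integral_eq_zero_of_primitive k (e + 1) hc (-(1 / 2))
      ((((continuous_const.mul (continuous_tt _ _ hc)).sub
        (continuous_const.mul (continuous_tt _ _ hc))).sub
        (continuous_const.mul (continuous_tt _ _ hc))).add
        (continuous_const.mul (continuous_tt _ _ hc))) fun t => ?_
    rw [tt_add_two k (e + 1) hc, tt_eq k (e + 1) hc, tt_add_two_pred k e hc,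
      tt_eq_pred k e hc, Real.cos_sq']
    generalize (uu c * Real.cos t) ^ k * sg c t ^ ((k : ℤ) - 1) *
      zz c t ^ (((e + 1 : ℕ) : ℤ) - k - 3) = P
    rw [zz]
    push_cast
    ring
  have i (J E : ℕ) := (continuous_tt J E hc).intervalIntegrable
    (μ := MeasureTheory.volume) (-(Real.pi / 2)) (Real.pi / 2)
  rw [intervalIntegral.integral_add ((((i _ _).const_mul _).sub ((i _ _).const_mul _)).sub
      ((i _ _).const_mul _)) ((i _ _).const_mul _),
    intervalIntegral.integral_sub (((i _ _).const_mul _).sub ((i _ _).const_mul _))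
      ((i _ _).const_mul _),
    intervalIntegral.integral_sub ((i _ _).const_mul _) ((i _ _).const_mul _)] at key
  simp only [intervalIntegral.integral_const_mul] at key
  change ((k + 1) * (TT (k + 2) (e + 1)).1 c - (k + 1) * (TT k (e + 1)).1 c) -
      (e + 1 / 2) * (TT (k + 2) (e + 1)).1 c =
    ((k + 1) * (TT (k + 2) e).1 c - (k + 1) * (TT k e).1 c) - e * (TT (k + 2) e).1 c
  simp only [TT_apply _ _ hc, TTFun]
  linarith

theorem theta_TT_succ_one (e : ℕ) :
    theta (TT 1 (e + 1)) - (e + 1 / 2 : ℝ) • TT 1 (e + 1) = theta (TT 1 e) - (e : ℝ) • TT 1 e := by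
  have h (E : ℕ) : TT 1 E = TT 3 E - (1 / 2 : ℝ) • theta (TT 3 E) := by
    have := theta_TT 1 E
    norm_num at this
    rw [this]
    module
  have h3 := theta_TT_succ_of_add_two 1 e
  norm_num at h3
  have h4 : theta (TT 3 (e + 1)) =
      (e + 1 / 2 : ℝ) • TT 3 (e + 1) + theta (TT 3 e) - (e : ℝ) • TT 3 e := by
    rw [add_sub_assoc, ← h3]
    abel
  have h5 := congrArg theta h4
  simp only [map_add, map_sub, map_smul] at h5
  rw [h (e + 1), h e]
  simp only [map_sub, map_smul, h5]
  rw [h4]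
  module

theorem theta_TT_succ {J : ℕ} (hJ : 1 ≤ J) (e : ℕ) :
    theta (TT J (e + 1)) - (e + 1 / 2 : ℝ) • TT J (e + 1) = theta (TT J e) - (e : ℝ) • TT J e := by
  obtain rfl | ⟨k, rfl⟩ : J = 1 ∨ ∃ k, J = k + 2 := by
    rcases Nat.lt_or_ge J 2 with h | h
    · left; omega
    · exact Or.inr ⟨J - 2, by omega⟩
  · exact theta_TT_succ_one e
  · exact theta_TT_succ_of_add_two k e

theorem theta_TT_one_zero : theta (TT 1 0) = -fpow 0 := by
  refine ext' fun c hc => ?_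
  have h1 : 1 - c ≠ 0 := by linarith [hc.2]
  have hu := (uu_pos hc).ne'
  have htt : tt 1 0 = fun c t => uu c * Real.cos t * (zz c t)⁻¹ := by
    funext c t
    simp [tt]
  have hd (t : ℝ) : HasDerivAt (fun t => -(1 / 2) * c / uu c * (Real.sin t * (zz c t)⁻¹))
      (c * deriv (fun c => tt 1 0 c t) c) t := by
    have hz := (zz_pos hc t).ne'
    have e1 := ((hasDerivAt_uu hc).mul_const (Real.cos t)).mul ((hasDerivAt_zz_left c t).inv hz)
    have e2 := ((Real.hasDerivAt_sin t).mul ((hasDerivAt_zz_right c t).inv hz)).const_mul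
      (-(1 / 2) * c / uu c)
    refine e2.congr_deriv ?_
    rw [htt]
    refine Eq.trans ?_ (congrArg (c * ·) e1.deriv.symm)
    have hz' := hz
    rw [zz] at hz'
    simp only [Pi.inv_apply, zz]
    field_simp
    rw [uu_sq hc]
    ring
  have key := intervalIntegral.integral_eq_sub_of_hasDerivAt (a := -(Real.pi / 2))
    (b := Real.pi / 2) (fun t _ => hd t)
    ((continuous_const.mul (continuous_deriv_tt 1 0 hc)).intervalIntegrable _ _)
  rw [intervalIntegral.integral_const_mul] at key
  rw [theta_TT_apply _ _ hc, key]
  change _ = -(fpow 0).1 c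
  have hc0 := hc.1.ne'
  have e : (fpow 0).1 c = 1 / uu c := by
    have h2 : 0 ≤ 1 - c := by linarith [hc.2]
    rw [fpow_apply 0 hc, uu, Real.sqrt_eq_rpow, one_div (_ ^ _ : ℝ), ← Real.rpow_neg h2]
    simp
  rw [e]
  have e2 : zz c (Real.pi / 2) = c := by simp [zz]
  have e3 : zz c (-(Real.pi / 2)) = c := by simp [zz]
  rw [e2, e3, Real.sin_neg, Real.sin_pi_div_two]
  field_simp
  ring

theorem TT_zero_zero : TT 0 0 = lam0 (1 / 2) 1 := by
  refine ext' fun c hc => ?_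
  rw [TT_apply _ _ hc, lam0_apply _ _ hc, TTFun, lamFun]
  refine intervalIntegral.integral_congr fun t _ => ?_
  have hs := sg_pos hc t
  have hw := wt_pos t
  have e1 : c + nd t = (sg c t * wt t) ^ 2 := by
    rw [mul_pow, sg_sq hc, nd, zz]
    have := wt_sq t
    linear_combination (1 - c) * this
  have : (c + nd t) ^ (-(1 / 2) : ℝ) = (sg c t * wt t)⁻¹ := by
    rw [e1, Real.rpow_neg (sq_nonneg _), ← Real.sqrt_eq_rpow, Real.sqrt_sq (by positivity)]
  simp only [tt, this, eval_one]
  simp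
  field_simp

end Sm

namespace Sm

theorem aeval_X_sub_C (a : ℝ) (f : Sm) : aeval theta (X - C a) f = theta f - a • f := by
  simp [Algebra.algebraMap_eq_smul_one]

theorem aeval_mul_apply (p q : ℝ[X]) (f : Sm) :
    aeval theta (p * q) f = aeval theta p (aeval theta q f) := by
  rw [map_mul]
  rfl

theorem aeval_TT {J : ℕ} (hJ : 1 ≤ J) (e : ℕ) :
    aeval theta (∏ l ∈ Finset.range e, (X - C (l + 1 / 2 : ℝ))) (TT J e) =
      aeval theta (∏ l ∈ Finset.range e, (X - C (l : ℝ))) (TT J 0) := by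
  induction e with
  | zero => simp
  | succ e ih =>
    rw [Finset.prod_range_succ, aeval_mul_apply, aeval_X_sub_C, theta_TT_succ hJ, ← aeval_X_sub_C,
      ← aeval_mul_apply, mul_comm, aeval_mul_apply, ih, ← aeval_mul_apply,
      Finset.prod_range_succ, mul_comm]

theorem exists_aeval_TT_eq {J : ℕ} (hJ : 1 ≤ J) {e M : ℕ} (he : e ≤ M) :
    ∃ G : ℝ[X], G.natDegree ≤ M ∧
      aeval theta (∏ l ∈ Finset.range M, (X - C (l + 1 / 2 : ℝ))) (TT J e) =
        aeval theta G (TT J 0) := by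
  refine ⟨(∏ l ∈ Finset.Ico e M, (X - C (l + 1 / 2 : ℝ))) *
    ∏ l ∈ Finset.range e, (X - C (l : ℝ)), ?_, ?_⟩
  · refine natDegree_mul_le.trans ?_
    rw [natDegree_finsetProd_X_sub_C_eq_card, natDegree_finsetProd_X_sub_C_eq_card]
    simp
    omega
  · rw [← Finset.prod_range_mul_prod_Ico _ he, mul_comm, aeval_mul_apply, aeval_TT hJ,
      ← aeval_mul_apply]

theorem exists_aeval_TT_odd (k : ℕ) : ∃ r : ℝ,
    aeval theta (∏ i ∈ Finset.range (k + 1), (X - C (2 * i : ℝ))) (TT (2 * k + 1) 0) =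
      r • fpow 0 := by
  induction k with
  | zero => exact ⟨-1, by simp [theta_TT_one_zero]; module⟩
  | succ k ih =>
    obtain ⟨r, hr⟩ := ih
    have h : aeval theta (X - C (2 * (k + 1 : ℕ) : ℝ)) (TT (2 * (k + 1) + 1) 0) =
        (-(2 * k + 2) : ℝ) • TT (2 * k + 1) 0 := by
      have := theta_TT (2 * k + 1) 0
      rw [aeval_X_sub_C, show 2 * (k + 1) + 1 = 2 * k + 1 + 2 by ring, this]
      push_cast
      module
    refine ⟨-(2 * k + 2) * r, ?_⟩
    rw [Finset.prod_range_succ, aeval_mul_apply, h, map_smul, hr, mul_smul]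

theorem exists_aeval_TT_even (k : ℕ) : ∃ r : ℝ,
    aeval theta (∏ i ∈ Finset.range k, (X - C (2 * i + 1 : ℝ))) (TT (2 * k) 0) =
      r • lam0 (1 / 2) 1 := by
  induction k with
  | zero => exact ⟨1, by simp [TT_zero_zero]⟩
  | succ k ih =>
    obtain ⟨r, hr⟩ := ih
    have h : aeval theta (X - C (2 * k + 1 : ℝ)) (TT (2 * (k + 1)) 0) =
        (-(2 * k + 1) : ℝ) • TT (2 * k) 0 := by
      have := theta_TT (2 * k) 0
      rw [aeval_X_sub_C, show 2 * (k + 1) = 2 * k + 2 by ring, this]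
      push_cast
      module
    refine ⟨-(2 * k + 1) * r, ?_⟩
    rw [Finset.prod_range_succ, aeval_mul_apply, h, map_smul, hr, mul_smul]

/-- The annihilating factor for the half-integer exponents. -/
noncomputable def polyHalf (N : ℕ) : ℝ[X] := ∏ l ∈ Finset.range (N + 1), (X - C (l + 1 / 2 : ℝ))

/-- The annihilating factor for the even exponents. -/
noncomputable def polyEven (N : ℕ) : ℝ[X] := ∏ i ∈ Finset.range (N + 1), (X - C (2 * i : ℝ))

/-- The annihilating factor for the odd exponents. -/
noncomputable def polyOdd (N : ℕ) : ℝ[X] := ∏ i ∈ Finset.range N, (X - C (2 * i + 1 : ℝ))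

theorem exists_aeval_TT_odd_le {k N : ℕ} (hk : k ≤ N) : ∃ g : ℝ[X], g.natDegree ≤ N ∧
    aeval theta (polyEven N) (TT (2 * k + 1) 0) = aeval theta g (fpow 0) := by
  obtain ⟨r, hr⟩ := exists_aeval_TT_odd k
  refine ⟨r • ∏ i ∈ Finset.Ico (k + 1) (N + 1), (X - C (2 * i : ℝ)), ?_, ?_⟩
  · refine (natDegree_smul_le _ _).trans ?_
    rw [natDegree_finsetProd_X_sub_C_eq_card]
    simp
  · rw [polyEven, ← Finset.prod_range_mul_prod_Ico _ (Nat.succ_le_succ hk), mul_comm,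
      aeval_mul_apply, hr, map_smul, map_smul]
    rfl

theorem exists_aeval_TT_even_le {k N : ℕ} (hk0 : 1 ≤ k) (hk : k ≤ N) :
    ∃ g : ℝ[X], g.natDegree + 1 ≤ N ∧
    aeval theta (polyOdd N) (TT (2 * k) 0) = aeval theta g (lam0 (1 / 2) 1) := by
  obtain ⟨r, hr⟩ := exists_aeval_TT_even k
  refine ⟨r • ∏ i ∈ Finset.Ico k N, (X - C (2 * i + 1 : ℝ)), ?_, ?_⟩
  · have := natDegree_smul_le r (∏ i ∈ Finset.Ico k N, (X - C (2 * i + 1 : ℝ)))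
    rw [natDegree_finsetProd_X_sub_C_eq_card] at this
    simp only [Nat.card_Ico] at this
    omega
  · rw [polyOdd, ← Finset.prod_range_mul_prod_Ico _ hk, mul_comm,
      aeval_mul_apply, hr, map_smul, map_smul]
    rfl

theorem aeval_mem_of_span {n : ℕ} {φ : Sm}
    (hφ : φ ∈ Submodule.span ℝ {f | ∃ j ≤ n, ∃ e ≤ n / 2, f = TT (j + 1) (e + 1)}) :
    ∃ p q : ℝ[X], p.natDegree ≤ n + n / 2 + 1 ∧ q.natDegree ≤ n ∧
      aeval theta (polyHalf (n / 2) * polyEven (n / 2) * polyOdd ((n + 1) / 2)) φ =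
        aeval theta p (fpow 0) + aeval theta (q * polyEven (n / 2)) (lam0 (1 / 2) 1) := by
  induction hφ using Submodule.span_induction with
  | mem f hf =>
    obtain ⟨j, hj, e, he, rfl⟩ := hf
    obtain ⟨G, hG, hGe⟩ := exists_aeval_TT_eq (J := j + 1) (by omega) (Nat.succ_le_succ he)
    rcases Nat.even_or_odd' j with ⟨k, rfl | rfl⟩
    · obtain ⟨g, hg, hge⟩ := exists_aeval_TT_odd_le (k := k) (N := n / 2) (by omega)
      refine ⟨polyOdd ((n + 1) / 2) * G * g, 0, ?_, by simp, ?_⟩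
      · have h1 : (polyOdd ((n + 1) / 2)).natDegree = (n + 1) / 2 := by
          rw [polyOdd, natDegree_finsetProd_X_sub_C_eq_card, Finset.card_range]
        have h2 := natDegree_mul_le (p := polyOdd ((n + 1) / 2)) (q := G)
        have h3 := natDegree_mul_le (p := polyOdd ((n + 1) / 2) * G) (q := g)
        omega
      · rw [show polyHalf (n / 2) * polyEven (n / 2) * polyOdd ((n + 1) / 2) =
          polyOdd ((n + 1) / 2) * polyEven (n / 2) * polyHalf (n / 2) by ring, aeval_mul_apply,
          polyHalf, hGe, ← aeval_mul_apply,
          show polyOdd ((n + 1) / 2) * polyEven (n / 2) * G =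
          polyOdd ((n + 1) / 2) * G * polyEven (n / 2) by ring, aeval_mul_apply, hge,
          ← aeval_mul_apply]
        simp
    · obtain ⟨g, hg, hge⟩ := exists_aeval_TT_even_le (k := k + 1) (N := (n + 1) / 2)
        (by omega) (by omega)
      refine ⟨0, G * g, by simp, ?_, ?_⟩
      · have := natDegree_mul_le (p := G) (q := g)
        omega
      · rw [show polyHalf (n / 2) * polyEven (n / 2) * polyOdd ((n + 1) / 2) =
          polyEven (n / 2) * polyOdd ((n + 1) / 2) * polyHalf (n / 2) by ring, aeval_mul_apply,
          polyHalf, hGe, ← aeval_mul_apply,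
          show polyEven (n / 2) * polyOdd ((n + 1) / 2) * G =
          G * polyEven (n / 2) * polyOdd ((n + 1) / 2) by ring, aeval_mul_apply,
          show 2 * k + 1 + 1 = 2 * (k + 1) by ring, hge, ← aeval_mul_apply,
          show G * polyEven (n / 2) * g = G * g * polyEven (n / 2) by ring]
        simp
  | zero => exact ⟨0, 0, by simp, by simp, by simp⟩
  | add f g _ _ hf hg =>
    obtain ⟨p, q, hp, hq, h⟩ := hf
    obtain ⟨p', q', hp', hq', h'⟩ := hg
    refine ⟨p + p', q + q', natDegree_add_le_of_degree_le hp hp',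
      natDegree_add_le_of_degree_le hq hq', ?_⟩
    rw [map_add, h, h', add_mul, map_add, map_add, LinearMap.add_apply, LinearMap.add_apply]
    abel
  | smul a f _ hf =>
    obtain ⟨p, q, hp, hq, h⟩ := hf
    refine ⟨a • p, a • q, (natDegree_smul_le _ _).trans hp, (natDegree_smul_le _ _).trans hq, ?_⟩
    rw [map_smul, h, smul_mul_assoc, map_smul, map_smul, smul_add]
    rfl

theorem zb_of_span {n : ℕ} {φ : Sm}
    (hφ : φ ∈ Submodule.span ℝ {f | ∃ j ≤ n, ∃ e ≤ n / 2, f = TT (j + 1) (e + 1)}) :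
    ZB φ.1 (4 * n + 3 * (n / 2) + 5) := by
  obtain ⟨p, q, hp, hq, h⟩ := aeval_mem_of_span hφ
  have h1 := zb_main hp hq
  rw [polyEven] at h
  rw [← h, mul_assoc, aeval_mul_apply, aeval_mul_apply] at h1
  have h2 := zb_of_aeval_theta _ _ (zb_of_aeval_theta _ _ (zb_of_aeval_theta _ _ h1))
  simp only [Finset.card_range] at h2
  rwa [show 3 * n + 2 * (n / 2) + 3 + (n / 2 + 1) + (n / 2 + 1) + (n + 1) / 2 =
    4 * n + 3 * (n / 2) + 5 by omega] at h2

end Sm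

/-- The abscissa along the parametrised oval. -/
noncomputable def xx (c t : ℝ) : ℝ := (1 + uu c * Real.sin t) / 2

/-- The relative height `(2 y - (1 - x)) / (1 - x)` along the parametrised upper arc. -/
noncomputable def rho (c t : ℝ) : ℝ := uu c * Real.cos t * sg c t / zz c t

/-- The ordinate along the upper arc (`s = 1`), the lower arc (`s = -1`) and the
middle line (`s = 0`). -/
noncomputable def yy (s c t : ℝ) : ℝ := (1 - xx c t) / 2 * (1 + s * rho c t)

theorem contDiff_xx (c : ℝ) : ContDiff ℝ ∞ (xx c) := by
  unfold xx
  fun_prop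

theorem hasDerivAt_xx (c t : ℝ) : HasDerivAt (xx c) (uu c * Real.cos t / 2) t :=
  (((Real.hasDerivAt_sin t).const_mul (uu c)).const_add 1).div_const 2

theorem contDiff_rho {c : ℝ} (hc : c ∈ Ioo (0 : ℝ) 1) : ContDiff ℝ ∞ (rho c) := by
  have h : ContDiffOn ℝ ∞ (fun p : ℝ × ℝ => rho p.1 p.2) (Ioo (0 : ℝ) 1 ×ˢ univ) := by
    have hcos : ContDiff ℝ ∞ fun p : ℝ × ℝ => Real.cos p.2 := Real.contDiff_cos.comp contDiff_snd
    exact ((contDiffOn_uu.mul hcos.contDiffOn).mul contDiffOn_sg).div contDiff_zz.contDiffOn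
      fun p hp => (zz_pos hp.1 p.2).ne'
  rw [← contDiffOn_univ]
  exact h.comp (f := fun t : ℝ => (c, t)) (by fun_prop) fun t _ => ⟨hc, mem_univ _⟩

theorem contDiff_yy (s : ℝ) {c : ℝ} (hc : c ∈ Ioo (0 : ℝ) 1) : ContDiff ℝ ∞ (yy s c) :=
  ((contDiff_const.sub (contDiff_xx c)).div_const 2).mul
    (contDiff_const.add (contDiff_const.mul (contDiff_rho hc)))

theorem zz_eq {c : ℝ} (hc : c ∈ Ioo (0 : ℝ) 1) (t : ℝ) :
    zz c t = 4 * (xx c t * (1 - xx c t)) := by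
  rw [zz, ← uu_sq hc, xx]
  ring

theorem xx_neg (c t : ℝ) : xx c (-t) = 1 - xx c t := by
  rw [xx, xx, Real.sin_neg]
  ring

theorem rho_neg (c t : ℝ) : rho c (-t) = rho c t := by
  simp [rho, sg, zz]

theorem exists_powerSum_poly (m : ℕ) : ∃ Q : ℝ[X], Q.natDegree ≤ m / 2 ∧
    ∀ x : ℝ, x ^ m + (1 - x) ^ m = Q.eval (4 * (x * (1 - x))) := by
  induction m using Nat.strong_induction_on with
  | _ m ih =>
    rcases m with _ | _ | m
    · exact ⟨C 2, by simp, fun x => by simp; norm_num⟩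
    · exact ⟨C 1, by simp, fun x => by simp⟩
    · obtain ⟨Q, hQ, hQe⟩ := ih (m + 1) (by omega)
      obtain ⟨R, hR, hRe⟩ := ih m (by omega)
      refine ⟨Q - C (1 / 4) * X * R, ?_, fun x => ?_⟩
      · refine (natDegree_sub_le _ _).trans (max_le (by omega) ?_)
        have h1 := natDegree_mul_le (p := C (1 / 4 : ℝ) * X) (q := R)
        have h2 : (C (1 / 4 : ℝ) * X).natDegree ≤ 1 := by compute_degree
        omega
      · simp only [eval_sub, eval_mul, eval_C, eval_X, ← hQe, ← hRe]
        ring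

theorem exists_symm_poly (i k : ℕ) : ∃ Q : ℝ[X], Q.natDegree ≤ (i + k) / 2 ∧
    ∀ x : ℝ, x ^ i * (1 - x) ^ k + (1 - x) ^ i * x ^ k = Q.eval (4 * (x * (1 - x))) := by
  wlog h : i ≤ k generalizing i k
  · obtain ⟨Q, hQ, hQe⟩ := this k i (by omega)
    exact ⟨Q, by omega, fun x => by rw [← hQe]; ring⟩
  · obtain ⟨m, rfl⟩ := Nat.exists_eq_add_of_le h
    obtain ⟨Q, hQ, hQe⟩ := exists_powerSum_poly m
    refine ⟨(C (1 / 4) * X) ^ i * Q, ?_, fun x => ?_⟩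
    · have h1 := natDegree_mul_le (p := (C (1 / 4 : ℝ) * X) ^ i) (q := Q)
      have h2 := natDegree_pow_le_of_le i
        (show (C (1 / 4 : ℝ) * X).natDegree ≤ 1 by compute_degree)
      omega
    · simp only [eval_mul, eval_pow, eval_C, eval_X, ← hQe]
      rw [show 1 / 4 * (4 * (x * (1 - x))) = x * (1 - x) by ring, mul_pow]
      ring

/-- The span of the basic integrals occurring in degree `n`. -/
noncomputable def melSpan (n : ℕ) : Submodule ℝ Sm :=
  Submodule.span ℝ {f | ∃ j ≤ n, ∃ e ≤ n / 2, f = Sm.TT (j + 1) (e + 1)}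

/-- `F` agrees on `(0, 1)` with an element of `melSpan n`. -/
def InMelSpan (n : ℕ) (F : ℝ → ℝ) : Prop :=
  ∃ φ ∈ melSpan n, ∀ c ∈ Ioo (0 : ℝ) 1, F c = φ.1 c

namespace InMelSpan

variable {n : ℕ} {F G : ℝ → ℝ}

theorem congr (hF : InMelSpan n F) (h : ∀ c ∈ Ioo (0 : ℝ) 1, G c = F c) : InMelSpan n G := by
  obtain ⟨φ, hφ, e⟩ := hF
  exact ⟨φ, hφ, fun c hc => (h c hc).trans (e c hc)⟩

theorem add (hF : InMelSpan n F) (hG : InMelSpan n G) : InMelSpan n fun c => F c + G c := by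
  obtain ⟨φ, hφ, e⟩ := hF
  obtain ⟨ψ, hψ, e'⟩ := hG
  refine ⟨φ + ψ, add_mem hφ hψ, fun c hc => ?_⟩
  simp only [e c hc, e' c hc]
  rfl

theorem const_mul (r : ℝ) (hF : InMelSpan n F) : InMelSpan n fun c => r * F c := by
  obtain ⟨φ, hφ, e⟩ := hF
  refine ⟨r • φ, Submodule.smul_mem _ r hφ, fun c hc => ?_⟩
  simp only [e c hc]
  rfl

theorem sub (hF : InMelSpan n F) (hG : InMelSpan n G) : InMelSpan n fun c => F c - G c :=
  (hF.add (hG.const_mul (-1))).congr fun c _ => by ring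

theorem sum {ι : Type*} (s : Finset ι) {F : ι → ℝ → ℝ} (h : ∀ i ∈ s, InMelSpan n (F i)) :
    InMelSpan n fun c => ∑ i ∈ s, F i c := by
  classical
  induction s using Finset.induction_on with
  | empty => exact ⟨0, zero_mem _, fun c _ => by simp⟩
  | insert i s hi ih =>
    refine ((h i (by simp)).add (ih fun j hj => h j (by simp [hj]))).congr fun c _ => ?_
    rw [Finset.sum_insert hi]

end InMelSpan

theorem inMelSpan_poly_rho {n l : ℕ} {Q : ℝ[X]} (hQ : Q.natDegree ≤ n / 2) (hl : l ≤ n) :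
    InMelSpan n fun c => ∫ t in (-(Real.pi / 2))..(Real.pi / 2),
      Q.eval (zz c t) * rho c t ^ l * (uu c * Real.cos t) := by
  have h : InMelSpan n fun c => ∑ e ∈ Finset.range (n / 2 + 1), Q.coeff e * TTFun (l + 1) (e + 1) c := by
    refine InMelSpan.sum _ fun e he => InMelSpan.const_mul _ ?_
    exact ⟨Sm.TT (l + 1) (e + 1),
      Submodule.subset_span ⟨l, hl, e, Nat.lt_succ_iff.1 (Finset.mem_range.1 he), rfl⟩,
      fun c hc => (Sm.TT_apply _ _ hc).symm⟩
  refine h.congr fun c hc => ?_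
  simp only [TTFun, ← intervalIntegral.integral_const_mul]
  rw [← intervalIntegral.integral_finsetSum fun e _ =>
    ((continuous_tt _ _ hc).intervalIntegrable _ _).const_mul _]
  refine intervalIntegral.integral_congr fun t _ => ?_
  have hz := (zz_pos hc t).ne'
  simp only [eval_eq_sum_range' (Nat.lt_succ_of_le hQ), Finset.sum_mul]
  refine Finset.sum_congr rfl fun e _ => ?_
  have e1 : zz c t ^ (((e + 1 : ℕ) : ℤ) - ((l + 1 : ℕ) : ℤ)) = zz c t ^ e / zz c t ^ l := by
    rw [← zpow_natCast, ← zpow_natCast, ← zpow_sub₀ hz]; congr 1; push_cast; ring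
  have e2 : sg c t ^ (((l + 1 : ℕ) : ℤ) - 1) = sg c t ^ l := by
    rw [← zpow_natCast]; congr 1; push_cast; ring
  rw [tt, e1, e2, rho]
  ring

theorem inMelSpan_xx_rho {n i k l : ℕ} (hik : i + k ≤ n) (hl : l ≤ n) :
    InMelSpan n fun c => ∫ t in (-(Real.pi / 2))..(Real.pi / 2),
      xx c t ^ i * (1 - xx c t) ^ k * rho c t ^ l * (uu c * Real.cos t) := by
  obtain ⟨Q, hQ, hQe⟩ := exists_symm_poly i k
  refine ((inMelSpan_poly_rho (n := n) (hQ.trans (by omega)) hl).const_mul (1 / 2)).congr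
    fun c hc => ?_
  have cx := (contDiff_xx c).continuous
  have cr := (contDiff_rho hc).continuous
  have cc := Real.continuous_cos
  have e1 := intervalIntegral.integral_comp_neg (a := -(Real.pi / 2)) (b := Real.pi / 2)
    fun t => xx c t ^ i * (1 - xx c t) ^ k * rho c t ^ l * (uu c * Real.cos t)
  simp only [xx_neg, rho_neg, Real.cos_neg, neg_neg, sub_sub_cancel] at e1
  have e2 := intervalIntegral.integral_add (μ := MeasureTheory.volume)
    (Continuous.intervalIntegrable (u := fun t => xx c t ^ i * (1 - xx c t) ^ k * rho c t ^ l *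
      (uu c * Real.cos t)) (by fun_prop) (-(Real.pi / 2)) (Real.pi / 2))
    (Continuous.intervalIntegrable (u := fun t => (1 - xx c t) ^ i * xx c t ^ k * rho c t ^ l *
      (uu c * Real.cos t)) (by fun_prop) (-(Real.pi / 2)) (Real.pi / 2))
  have e3 : ∀ t, Q.eval (zz c t) * rho c t ^ l * (uu c * Real.cos t) =
      xx c t ^ i * (1 - xx c t) ^ k * rho c t ^ l * (uu c * Real.cos t) +
      (1 - xx c t) ^ i * xx c t ^ k * rho c t ^ l * (uu c * Real.cos t) := fun t => by
    rw [zz_eq hc, ← hQe]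
    ring
  simp only [e3]
  rw [e2, e1]
  ring

theorem inMelSpan_monomial {n i k : ℕ} (s : ℝ) (hik : i + k ≤ n) :
    InMelSpan n fun c => ∫ t in (-(Real.pi / 2))..(Real.pi / 2),
      xx c t ^ i * yy s c t ^ k * (uu c * Real.cos t / 2) := by
  have h : InMelSpan n fun c => ∑ l ∈ Finset.range (k + 1),
      (s ^ l * k.choose l * (1 / 2) ^ (k + 1)) * ∫ t in (-(Real.pi / 2))..(Real.pi / 2),
        xx c t ^ i * (1 - xx c t) ^ k * rho c t ^ l * (uu c * Real.cos t) := by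
    refine InMelSpan.sum _ fun l hl => InMelSpan.const_mul _ ?_
    have := Finset.mem_range.1 hl
    exact inMelSpan_xx_rho hik (by omega)
  refine h.congr fun c hc => ?_
  have cx := (contDiff_xx c).continuous
  have cr := (contDiff_rho hc).continuous
  simp only [← intervalIntegral.integral_const_mul]
  rw [← intervalIntegral.integral_finsetSum fun l _ =>
    Continuous.intervalIntegrable (by fun_prop) _ _]
  refine intervalIntegral.integral_congr fun t _ => ?_
  simp only [yy, mul_pow]
  rw [add_comm 1, add_pow, Finset.mul_sum, Finset.mul_sum, Finset.sum_mul]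
  refine Finset.sum_congr rfl fun l _ => ?_
  rw [div_eq_mul_one_div, mul_pow, mul_pow]
  ring

theorem inMelSpan_monomial_deriv {n i k : ℕ} (s : ℝ) (hik : i + k ≤ n) :
    InMelSpan n fun c => ∫ t in (-(Real.pi / 2))..(Real.pi / 2),
      xx c t ^ i * yy s c t ^ k * deriv (yy s c) t := by
  have h (s : ℝ) : InMelSpan n fun c => (i : ℝ) * ∫ t in (-(Real.pi / 2))..(Real.pi / 2),
      xx c t ^ (i - 1) * yy s c t ^ (k + 1) * (uu c * Real.cos t / 2) := by
    rcases Nat.eq_zero_or_pos i with rfl | hi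
    · exact ⟨0, zero_mem _, fun c _ => by simp⟩
    · exact (inMelSpan_monomial s (by omega)).const_mul _
  refine ((((h 0).sub (h s)).sub ((inMelSpan_monomial 0 hik).const_mul ((k + 1) / 2))).const_mul
    (1 / (k + 1))).congr fun c hc => ?_
  have hd (s t : ℝ) : HasDerivAt (fun t => xx c t ^ i * yy s c t ^ (k + 1))
      (i * (xx c t ^ (i - 1) * yy s c t ^ (k + 1) * (uu c * Real.cos t / 2)) +
        (k + 1) * (xx c t ^ i * yy s c t ^ k * deriv (yy s c) t)) t := by
    have h1 : HasDerivAt (yy s c) (deriv (yy s c) t) t :=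
      ((contDiff_yy s hc).differentiable (by simp) t).hasDerivAt
    refine (((hasDerivAt_xx c t).pow i).mul (h1.pow (k + 1))).congr_deriv ?_
    simp only [Pi.pow_apply, Nat.add_sub_cancel]
    push_cast
    ring
  have cx := (contDiff_xx c).continuous
  have cy (s : ℝ) := (contDiff_yy s hc).continuous
  have cd (s : ℝ) := (contDiff_yy s hc).continuous_deriv (by simp)
  have key (s : ℝ) : (i : ℝ) * (∫ t in (-(Real.pi / 2))..(Real.pi / 2),
        xx c t ^ (i - 1) * yy s c t ^ (k + 1) * (uu c * Real.cos t / 2)) +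
      (k + 1) * (∫ t in (-(Real.pi / 2))..(Real.pi / 2),
        xx c t ^ i * yy s c t ^ k * deriv (yy s c) t) =
      xx c (Real.pi / 2) ^ i * yy s c (Real.pi / 2) ^ (k + 1) -
        xx c (-(Real.pi / 2)) ^ i * yy s c (-(Real.pi / 2)) ^ (k + 1) := by
    have cy := cy s
    have cd := cd s
    rw [← intervalIntegral.integral_eq_sub_of_hasDerivAt (fun t _ => hd s t)
      (Continuous.intervalIntegrable (by fun_prop) _ _), intervalIntegral.integral_add
      (Continuous.intervalIntegrable (by fun_prop) _ _)
      (Continuous.intervalIntegrable (by fun_prop) _ _), intervalIntegral.integral_const_mul,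
      intervalIntegral.integral_const_mul]
  have b1 : yy s c (Real.pi / 2) = yy 0 c (Real.pi / 2) := by simp [yy, rho]
  have b2 : yy s c (-(Real.pi / 2)) = yy 0 c (-(Real.pi / 2)) := by simp [yy, rho]
  have d0 (t : ℝ) : deriv (yy 0 c) t = -(1 / 2) * (uu c * Real.cos t / 2) := by
    have : yy 0 c = fun t => (1 - xx c t) / 2 := by funext t; simp [yy]
    rw [this]
    exact ((((hasDerivAt_xx c t).const_sub 1).div_const 2).congr_deriv (by ring)).deriv
  have k1 := key s
  rw [b1, b2, ← key 0] at k1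
  have e : (∫ t in (-(Real.pi / 2))..(Real.pi / 2), xx c t ^ i * yy 0 c t ^ k * deriv (yy 0 c) t) =
      -(1 / 2) * ∫ t in (-(Real.pi / 2))..(Real.pi / 2),
        xx c t ^ i * yy 0 c t ^ k * (uu c * Real.cos t / 2) := by
    rw [← intervalIntegral.integral_const_mul]
    refine intervalIntegral.integral_congr fun t _ => ?_
    simp only [d0]
    ring
  rw [e] at k1
  have hk : (k + 1 : ℝ) ≠ 0 := by positivity
  rw [one_div, eq_inv_mul_iff_mul_eq₀ hk]
  linear_combination k1

/-- The two arcs of the level curve at once. -/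
noncomputable def arc (s h x : ℝ) : ℝ :=
  (1 - x) / 2 + s * √(x ^ 4 - 2 * x ^ 3 + x ^ 2 - 4 * h) / (2 * x)

theorem arc_one : arc 1 = Yp := by
  funext h x
  simp [arc, Yp]

theorem arc_neg_one : arc (-1) = Ym := by
  funext h x
  rw [arc, Ym]
  ring

section parametrisation

variable {c : ℝ}

theorem uh_eq (hc : c ∈ Ioo (0 : ℝ) 1) : uh (c ^ 2 / 64) = uu c := by
  have : √(c ^ 2 / 64) = c / 8 := by
    rw [show c ^ 2 / 64 = (c / 8) ^ 2 by ring, Real.sqrt_sq (by linarith [hc.1])]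
  rw [uh, uu, this]
  congr 1
  ring

theorem xx_pos (hc : c ∈ Ioo (0 : ℝ) 1) (t : ℝ) : 0 < xx c t := by
  have h1 : uu c < 1 := by
    have := uu_sq hc
    nlinarith [uu_pos hc, hc.1]
  have h2 := uu_pos hc
  have h3 := Real.neg_one_le_sin t
  rw [xx]
  nlinarith

theorem one_sub_xx_pos (hc : c ∈ Ioo (0 : ℝ) 1) (t : ℝ) : 0 < 1 - xx c t := by
  rw [← xx_neg]
  exact xx_pos hc (-t)

theorem quartic_xx (hc : c ∈ Ioo (0 : ℝ) 1) (t : ℝ) :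
    xx c t ^ 4 - 2 * xx c t ^ 3 + xx c t ^ 2 - 4 * (c ^ 2 / 64) =
      (uu c * Real.cos t * sg c t / 4) ^ 2 := by
  have h := zz_eq hc t
  have h2 : (uu c * Real.cos t * sg c t / 4) ^ 2 = (zz c t ^ 2 - c ^ 2) / 16 := by
    rw [div_pow, mul_pow, mul_pow, uu_sq hc, sg_sq hc, Real.cos_sq', zz]
    ring
  rw [h2, h]
  ring

theorem arc_xx (hc : c ∈ Ioo (0 : ℝ) 1) (s : ℝ) {t : ℝ} (ht : 0 ≤ Real.cos t) :
    arc s (c ^ 2 / 64) (xx c t) = yy s c t := by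
  have h1 := (xx_pos hc t).ne'
  have h2 := (one_sub_xx_pos hc t).ne'
  rw [arc, quartic_xx hc, Real.sqrt_sq (div_nonneg (mul_nonneg (mul_nonneg (uu_pos hc).le ht)
    (sg_pos hc t).le) (by norm_num)), yy, rho, zz_eq hc]
  field_simp

theorem deriv_arc_xx (hc : c ∈ Ioo (0 : ℝ) 1) (s : ℝ) {t : ℝ} (ht : 0 < Real.cos t) :
    deriv (arc s (c ^ 2 / 64)) (xx c t) * (uu c * Real.cos t / 2) = deriv (yy s c) t := by
  have h1 := (xx_pos hc t).ne'
  have hd : DifferentiableAt ℝ (arc s (c ^ 2 / 64)) (xx c t) := by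
    have hq : xx c t ^ 4 - 2 * xx c t ^ 3 + xx c t ^ 2 - 4 * (c ^ 2 / 64) ≠ 0 := by
      rw [quartic_xx hc]
      have := uu_pos hc
      have := sg_pos hc t
      positivity
    have h3 : DifferentiableAt ℝ (fun x => √(x ^ 4 - 2 * x ^ 3 + x ^ 2 - 4 * (c ^ 2 / 64)))
        (xx c t) := DifferentiableAt.sqrt (by fun_prop) hq
    exact DifferentiableAt.add (by fun_prop)
      ((h3.const_mul s).div (by fun_prop) (mul_ne_zero two_ne_zero h1))
  rw [← (hd.hasDerivAt.comp t (hasDerivAt_xx c t)).deriv]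
  refine Filter.EventuallyEq.deriv_eq ?_
  filter_upwards [Real.continuous_cos.continuousAt.eventually (lt_mem_nhds ht)] with r hr
  exact arc_xx hc s hr.le

theorem image_xx (hc : c ∈ Ioo (0 : ℝ) 1) :
    xx c '' Ioo (-(Real.pi / 2)) (Real.pi / 2) = Ioo (x0 (c ^ 2 / 64)) (x1 (c ^ 2 / 64)) := by
  have hu := uu_pos hc
  rw [x0, x1, uh_eq hc]
  ext x
  constructor
  · rintro ⟨t, ht, rfl⟩
    have hs1 : Real.sin t < 1 := by
      rw [← Real.sin_pi_div_two]
      exact Real.sin_lt_sin_of_lt_of_le_pi_div_two ht.1.le le_rfl ht.2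
    have hs2 : -1 < Real.sin t := by
      rw [← Real.sin_pi_div_two, ← Real.sin_neg]
      exact Real.sin_lt_sin_of_lt_of_le_pi_div_two (by linarith) ht.2.le (by linarith [ht.1])
    rw [xx]
    constructor <;> nlinarith
  · rintro ⟨h1, h2⟩
    have h3 : (2 * x - 1) / uu c < 1 := by rw [div_lt_one hu]; linarith
    have h4 : -1 < (2 * x - 1) / uu c := by rw [lt_div_iff₀ hu]; linarith
    refine ⟨Real.arcsin ((2 * x - 1) / uu c), ⟨?_, ?_⟩, ?_⟩
    · exact Real.neg_pi_div_two_lt_arcsin.2 h4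
    · exact Real.arcsin_lt_pi_div_two.2 h3
    · rw [xx, Real.sin_arcsin h4.le h3.le]
      field_simp
      ring

theorem integral_arc (hc : c ∈ Ioo (0 : ℝ) 1) (s : ℝ) (f g : MvPolynomial (Fin 2) ℝ) :
    ∫ x in x0 (c ^ 2 / 64)..x1 (c ^ 2 / 64),
      (MvPolynomial.eval ![x, arc s (c ^ 2 / 64) x] g -
        MvPolynomial.eval ![x, arc s (c ^ 2 / 64) x] f * deriv (arc s (c ^ 2 / 64)) x) =
    ∫ t in (-(Real.pi / 2))..(Real.pi / 2),
      (MvPolynomial.eval ![xx c t, yy s c t] g * (uu c * Real.cos t / 2) -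
        MvPolynomial.eval ![xx c t, yy s c t] f * deriv (yy s c) t) := by
  have hu := uu_pos hc
  have hle : x0 (c ^ 2 / 64) ≤ x1 (c ^ 2 / 64) := by
    rw [x0, x1, uh_eq hc]
    linarith
  have hpi := Real.pi_pos
  rw [intervalIntegral.integral_of_le hle, MeasureTheory.integral_Ioc_eq_integral_Ioo,
    intervalIntegral.integral_of_le (by linarith), MeasureTheory.integral_Ioc_eq_integral_Ioo,
    ← image_xx hc, MeasureTheory.integral_image_eq_integral_abs_deriv_smul measurableSet_Ioo
    (fun t _ => (hasDerivAt_xx c t).hasDerivWithinAt)]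
  · refine MeasureTheory.setIntegral_congr_fun measurableSet_Ioo fun t ht => ?_
    have hcos := Real.cos_pos_of_mem_Ioo ht
    simp only [smul_eq_mul]
    rw [arc_xx hc s hcos.le, ← deriv_arc_xx hc s hcos, abs_of_pos (by positivity)]
    ring
  · intro a ha b hb hab
    refine Real.injOn_sin (Ioo_subset_Icc_self ha) (Ioo_subset_Icc_self hb) ?_
    simp only [xx] at hab
    exact mul_left_cancel₀ hu.ne' (by linarith)

end parametrisation

theorem eval_fin_two (p : MvPolynomial (Fin 2) ℝ) (x y : ℝ) :
    MvPolynomial.eval ![x, y] p = ∑ d ∈ p.support, p.coeff d * (x ^ d 0 * y ^ d 1) := by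
  rw [MvPolynomial.eval_eq']
  simp [Fin.prod_univ_two]

theorem add_le_of_mem_support {n : ℕ} {p : MvPolynomial (Fin 2) ℝ} (hp : p.totalDegree ≤ n)
    {d : Fin 2 →₀ ℕ} (hd : d ∈ p.support) : d 0 + d 1 ≤ n := by
  have := (MvPolynomial.le_totalDegree hd).trans hp
  rwa [Finsupp.sum_fintype _ _ (fun _ => rfl), Fin.sum_univ_two] at this

theorem inMelSpan_eval_mul {n : ℕ} (s : ℝ) {p : MvPolynomial (Fin 2) ℝ} (hp : p.totalDegree ≤ n)
    {w : ℝ → ℝ → ℝ} (hw : ∀ c ∈ Ioo (0 : ℝ) 1, Continuous (w c))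
    (h : ∀ i k, i + k ≤ n → InMelSpan n fun c => ∫ t in (-(Real.pi / 2))..(Real.pi / 2),
      xx c t ^ i * yy s c t ^ k * w c t) :
    InMelSpan n fun c => ∫ t in (-(Real.pi / 2))..(Real.pi / 2),
      MvPolynomial.eval ![xx c t, yy s c t] p * w c t := by
  refine (InMelSpan.sum p.support fun d hd =>
    (h (d 0) (d 1) (add_le_of_mem_support hp hd)).const_mul (p.coeff d)).congr fun c hc => ?_
  have cx := (contDiff_xx c).continuous
  have cy := (contDiff_yy s hc).continuous
  have cw := hw c hc
  simp only [← intervalIntegral.integral_const_mul]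
  rw [← intervalIntegral.integral_finsetSum fun l _ =>
    Continuous.intervalIntegrable (by fun_prop) _ _]
  refine intervalIntegral.integral_congr fun t _ => ?_
  simp only [eval_fin_two, Finset.sum_mul]
  exact Finset.sum_congr rfl fun d _ => by ring

theorem continuous_eval_oval (s : ℝ) {c : ℝ} (hc : c ∈ Ioo (0 : ℝ) 1)
    (p : MvPolynomial (Fin 2) ℝ) :
    Continuous fun t => MvPolynomial.eval ![xx c t, yy s c t] p := by
  have cx := (contDiff_xx c).continuous
  have cy := (contDiff_yy s hc).continuous
  simp only [eval_fin_two]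
  fun_prop

theorem inMelSpan_integral_arc {n : ℕ} (s : ℝ) {f g : MvPolynomial (Fin 2) ℝ}
    (hf : f.totalDegree ≤ n) (hg : g.totalDegree ≤ n) :
    InMelSpan n fun c => ∫ x in x0 (c ^ 2 / 64)..x1 (c ^ 2 / 64),
      (MvPolynomial.eval ![x, arc s (c ^ 2 / 64) x] g -
        MvPolynomial.eval ![x, arc s (c ^ 2 / 64) x] f * deriv (arc s (c ^ 2 / 64)) x) := by
  refine ((inMelSpan_eval_mul s hg (w := fun c t => uu c * Real.cos t / 2) (fun c _ => by fun_prop)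
    fun i k h => inMelSpan_monomial s h).sub (inMelSpan_eval_mul s hf
    (w := fun c => deriv (yy s c)) (fun c hc => (contDiff_yy s hc).continuous_deriv (by simp))
    fun i k h => inMelSpan_monomial_deriv s h)).congr fun c hc => ?_
  rw [integral_arc hc, intervalIntegral.integral_sub]
  · have := continuous_eval_oval s hc g
    exact Continuous.intervalIntegrable (by fun_prop) _ _
  · exact ((continuous_eval_oval s hc f).mul
      ((contDiff_yy s hc).continuous_deriv (by simp))).intervalIntegrable _ _

theorem inMelSpan_mel {n : ℕ} {fp fm gp gm : MvPolynomial (Fin 2) ℝ}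
    (hfp : fp.totalDegree ≤ n) (hfm : fm.totalDegree ≤ n)
    (hgp : gp.totalDegree ≤ n) (hgm : gm.totalDegree ≤ n) :
    InMelSpan n fun c => Mel fp fm gp gm (c ^ 2 / 64) := by
  have h := (inMelSpan_integral_arc 1 hfp hgp).sub (inMelSpan_integral_arc (-1) hfm hgm)
  rwa [arc_one, arc_neg_one] at h

theorem van_zeroMult (φ : ℝ → ℝ) (x : ℝ) : Van φ x (zeroMult φ x) := fun i hi => by
  by_contra h
  exact Nat.notMem_of_lt_sInf hi h

theorem sqrt_mem {h : ℝ} (hh : h ∈ Ioo (0 : ℝ) (1 / 64)) : 8 * √h ∈ Ioo (0 : ℝ) 1 := by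
  have h1 : √h < 1 / 8 := by
    rw [Real.sqrt_lt' (by norm_num)]
    linarith [hh.2]
  have h2 := Real.sqrt_pos.2 hh.1
  constructor <;> linarith

theorem sq_sqrt_div {h : ℝ} (hh : 0 < h) : (8 * √h) ^ 2 / 64 = h := by
  rw [mul_pow, Real.sq_sqrt hh.le]
  ring

theorem sum_zeroMult_le {M : ℝ → ℝ} {φ : Sm} {N : ℕ} (hφ : ZB φ.1 N)
    (hM : ∀ c ∈ Ioo (0 : ℝ) 1, M (c ^ 2 / 64) = φ.1 c)
    (hM0 : ¬ ∀ h ∈ Ioo (0 : ℝ) (1 / 64), M h = 0) (T : Finset ℝ)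
    (hT : ∀ x ∈ T, x ∈ Ioo (0 : ℝ) (1 / 64)) : ∑ x ∈ T, zeroMult M x ≤ N := by
  have hM' {h : ℝ} (hh : h ∈ Ioo (0 : ℝ) (1 / 64)) : M h = φ.1 (8 * √h) := by
    rw [← hM _ (sqrt_mem hh), sq_sqrt_div hh.1]
  have hsm {h : ℝ} (hh : h ∈ Ioo (0 : ℝ) (1 / 64)) : ContDiffAt ℝ ∞ M h := by
    have h1 : ContDiffAt ℝ ∞ φ.1 (8 * √h) :=
      (Sm.smooth φ).contDiffAt (Ioo_mem_nhds (sqrt_mem hh).1 (sqrt_mem hh).2)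
    have h2 : ContDiffAt ℝ ∞ (fun h => 8 * √h) h :=
      contDiffAt_const.mul (Real.contDiffAt_sqrt hh.1.ne')
    refine (h1.comp h h2).congr_of_eventuallyEq ?_
    filter_upwards [Ioo_mem_nhds hh.1 hh.2] with y hy
    exact hM' hy
  have hinj : Set.InjOn (fun h : ℝ => 8 * √h) T := fun a ha b hb hab => by
    have : (8 * √a) ^ 2 / 64 = (8 * √b) ^ 2 / 64 := by
      simp only at hab
      rw [hab]
    rwa [sq_sqrt_div (hT a ha).1, sq_sqrt_div (hT b hb).1] at this
  rcases hφ with h0 | hb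
  · exact absurd (fun h hh => (hM' hh).trans (h0 _ (sqrt_mem hh))) hM0
  have key := hb (T.image fun h => 8 * √h) (fun c => zeroMult M (c ^ 2 / 64)) fun c hc => by
    obtain ⟨h, hh, rfl⟩ := Finset.mem_image.1 hc
    have hmem := sqrt_mem (hT h hh)
    have e := sq_sqrt_div (hT h hh).1
    refine ⟨hmem, ?_⟩
    have hv : Van (M ∘ fun c => c ^ 2 / 64) (8 * √h) (zeroMult M ((8 * √h) ^ 2 / 64)) :=
      Van.comp (by fun_prop) (by rw [e]; exact hsm (hT h hh)) (van_zeroMult _ _)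
    refine hv.congr ?_
    filter_upwards [Ioo_mem_nhds hmem.1 hmem.2] with y hy
    exact hM y hy
  rw [Finset.sum_image hinj] at key
  refine le_trans (le_of_eq (Finset.sum_congr rfl fun h hh => ?_)) key
  rw [sq_sqrt_div (hT h hh).1]

end

/-- Theorem 1.5 of the paper: if the first-order Melnikov function of the
piecewise smooth perturbation of degree at most `n ≥ 3` is not identically zero on
`(0, 1/64)`, then it has at most `⌊11n/2⌋ + 43` zeros there, counted with multiplicity. -/
theorem melnikov_zero_bound (n : ℕ) (hn : 3 ≤ n)
    (fp fm gp gm : MvPolynomial (Fin 2) ℝ)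
    (hfp : fp.totalDegree ≤ n) (hfm : fm.totalDegree ≤ n)
    (hgp : gp.totalDegree ≤ n) (hgm : gm.totalDegree ≤ n)
    (hI : ¬ ∀ h ∈ Set.Ioo (0 : ℝ) (1 / 64), Mel fp fm gp gm h = 0) :
    ∀ T : Finset ℝ,
      (∀ x ∈ T, x ∈ Set.Ioo (0 : ℝ) (1 / 64) ∧ Mel fp fm gp gm x = 0) →
      ∑ x ∈ T, zeroMult (Mel fp fm gp gm) x ≤ 11 * n / 2 + 43 := by
  intro T hT
  obtain ⟨φ, hφ, hM⟩ := inMelSpan_mel hfp hfm hgp hgm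
  have := sum_zeroMult_le (Sm.zb_of_span hφ) hM hI T fun x hx => (hT x hx).1
  omega
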